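/- arXiv:1706.07653 — 2 statements merged into one kernel-verified Lean document; each statement's English description precedes it below -/
import Mathlib

section
/- For all a, y > 0 the limit ψ^GC(a,y) := lim_{n→∞} (1/(2n)) log P^GC_{2n}(a,y) exists and equals ψ^G(a,y), where ψ^G(a,y) = log 2 if a ≤ 2 and y ≤ 1; (1/2)log 2 + (1/2)log a − (1/4)log(a−1) if a > 2 and y ≤ 1; (1/2)log 2 + (1/2)log(y+1) − (1/4)log y if a ≤ 2 and y > 1; and (1/2)log a − (1/4)log(a−1) + (1/2)log(y+1) − (1/4)log y if a > 2 and y > 1. Moreover ψ^G(a,y) ≤ liminf_{n→∞} (1/(2n)) log P^C_{2n}(a,y). -/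
open Finset Filter

attribute [local instance] Classical.propDecidable

/-- Height (second coordinate) of a binomial path after `i` steps, starting at height `c`;
steps are encoded by `s : Fin n → Bool` (`true` = up step `(1,1)`, `false` = down step `(1,-1)`).
The path visits the points `(x₀ + i, hgt c s i)` for `0 ≤ i ≤ n`. -/
def hgt {n : ℕ} (c : ℤ) (s : Fin n → Bool) (i : ℕ) : ℤ :=
  c + ∑ j ∈ Finset.range i, (if h : j < n then (if s ⟨j, h⟩ then (1 : ℤ) else -1) else 0)

/-- The path lies in the upper half-plane (all second coordinates ≥ 0). -/
def InUHP {n : ℕ} (c : ℤ) (s : Fin n → Bool) : Prop :=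
  ∀ i ≤ n, 0 ≤ hgt c s i

/-- The number of vertices of the path with second coordinate 0. -/
def visits {n : ℕ} (c : ℤ) (s : Fin n → Bool) : ℕ :=
  ((Finset.range (n + 1)).filter (fun i => hgt c s i = 0)).card

/-- `(c, sp, sm)` encodes a staircase polygon of length `2n` in `𝒫^S_{2n}`:
both binomial paths of length `n` start at `(0, c)` (so the leftmost vertex has first
coordinate `0`), they end at the same point, the upper path `sp` is strictly above the
lower path `sm` at the intermediate points, the polygon lies in the upper half-plane,
and it has at least one vertex with second coordinate `0`. -/
def IsStaircase {n : ℕ} (c : ℤ) (sp sm : Fin n → Bool) : Prop :=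
  hgt c sp n = hgt c sm n ∧
  (∀ i, 0 < i → i < n → hgt c sm i < hgt c sp i) ∧
  InUHP c sp ∧ InUHP c sm ∧
  (∃ i ≤ n, hgt c sp i = 0 ∨ hgt c sm i = 0)

/-- `P^C_{2n}(a,y)`: partition function of centred staircase polygons of length `2n`,
i.e. those with `π⁻_{⌊n/2⌋}` having second coordinate `0`. -/
noncomputable def PC (n : ℕ) (a y : ℝ) : ℝ :=
  ∑ p ∈ (Finset.univ : Finset (Fin (n + 1) × (Fin n → Bool) × (Fin n → Bool))).filter
      (fun p => IsStaircase ((p.1 : ℕ) : ℤ) p.2.1 p.2.2 ∧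
        hgt ((p.1 : ℕ) : ℤ) p.2.2 (n / 2) = 0),
    a ^ visits ((p.1 : ℕ) : ℤ) p.2.2 * y ^ hgt ((p.1 : ℕ) : ℤ) p.2.1 (n / 2)

/-- `P^GC_{2n}(a,y)`: partition function of grafted-and-centred staircase polygons of
length `2n`: centred (`π⁻_{⌊n/2⌋}` has second coordinate `0`), with the leftmost and
rightmost vertices at the smallest possible heights according to `n mod 4`. -/
noncomputable def PGC (n : ℕ) (a y : ℝ) : ℝ :=
  ∑ p ∈ (Finset.univ : Finset (Fin (n + 1) × (Fin n → Bool) × (Fin n → Bool))).filter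
      (fun p => IsStaircase ((p.1 : ℕ) : ℤ) p.2.1 p.2.2 ∧
        hgt ((p.1 : ℕ) : ℤ) p.2.2 (n / 2) = 0 ∧
        (n % 4 = 0 → ((p.1 : ℕ) : ℤ) = 2 ∧ hgt ((p.1 : ℕ) : ℤ) p.2.1 n = 2) ∧
        (n % 4 = 1 → ((p.1 : ℕ) : ℤ) = 2 ∧ hgt ((p.1 : ℕ) : ℤ) p.2.1 n = 1) ∧
        (n % 4 = 2 → ((p.1 : ℕ) : ℤ) = 1 ∧ hgt ((p.1 : ℕ) : ℤ) p.2.1 n = 1) ∧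
        (n % 4 = 3 → ((p.1 : ℕ) : ℤ) = 1 ∧ hgt ((p.1 : ℕ) : ℤ) p.2.1 n = 2)),
    a ^ visits ((p.1 : ℕ) : ℤ) p.2.2 * y ^ hgt ((p.1 : ℕ) : ℤ) p.2.1 (n / 2)

/-- The value of the free energy `ψ^G(a,y)` of grafted staircase polygons. -/
noncomputable def psiGval (a y : ℝ) : ℝ :=
  if a ≤ 2 then
    (if y ≤ 1 then Real.log 2
     else (1/2) * Real.log 2 + (1/2) * Real.log (y+1) - (1/4) * Real.log y)
  else
    (if y ≤ 1 then (1/2) * Real.log 2 + (1/2) * Real.log a - (1/4) * Real.log (a-1)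
     else (1/2) * Real.log a - (1/4) * Real.log (a-1)
          + (1/2) * Real.log (y+1) - (1/4) * Real.log y)


/-! ### Path sums as a recursion -/

/-- Forward evolution of the weighted number of paths from `c`. -/
noncomputable def mu (V : ℕ → ℤ → ℝ) (c : ℤ) : ℕ → ℤ → ℝ
  | 0, h => if h = c then V 0 c else 0
  | (i+1), h => V (i+1) h * (mu V c i (h-1) + mu V c i (h+1))

theorem mu_nonneg (V : ℕ → ℤ → ℝ) (c : ℤ) (hV : ∀ i h, 0 ≤ V i h) (i : ℕ) (h : ℤ) :
    0 ≤ mu V c i h := by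
  induction i generalizing h with
  | zero => simp only [mu]; split_ifs <;> simp [hV]
  | succ i ih => simp only [mu]; exact mul_nonneg (hV _ _) (add_nonneg (ih _) (ih _))

theorem hgt_zero {n : ℕ} (c : ℤ) (s : Fin n → Bool) : hgt c s 0 = c := by simp [hgt]

theorem hgt_succ {n : ℕ} (c : ℤ) (s : Fin n → Bool) (i : ℕ) :
    hgt c s (i+1) = hgt c s i + (if h : i < n then (if s ⟨i, h⟩ then (1 : ℤ) else -1) else 0) := by
  simp [hgt, Finset.sum_range_succ, add_assoc]

theorem hgt_snoc {n : ℕ} (c : ℤ) (s : Fin n → Bool) (b : Bool) (i : ℕ) (hi : i ≤ n) :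
    hgt c (Fin.snoc s b : Fin (n+1) → Bool) i = hgt c s i := by
  unfold hgt
  congr 1
  apply Finset.sum_congr rfl
  intro j hj
  have hj' : j < n := lt_of_lt_of_le (Finset.mem_range.1 hj) hi
  have : (⟨j, by omega⟩ : Fin (n+1)) = Fin.castSucc ⟨j, hj'⟩ := rfl
  rw [dif_pos hj', dif_pos (by omega : j < n+1), this, Fin.snoc_castSucc]

theorem hgt_snoc_last {n : ℕ} (c : ℤ) (s : Fin n → Bool) (b : Bool) :
    hgt c (Fin.snoc s b : Fin (n+1) → Bool) (n+1) = hgt c s n + (if b then 1 else -1) := by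
  rw [hgt_succ, hgt_snoc c s b n le_rfl, dif_pos (Nat.lt_succ_self n)]
  have : (⟨n, Nat.lt_succ_self n⟩ : Fin (n+1)) = Fin.last n := rfl
  rw [this, Fin.snoc_last]

theorem pathsum (V : ℕ → ℤ → ℝ) (c : ℤ) (n : ℕ) (h : ℤ) :
    ∑ s : Fin n → Bool, (if hgt c s n = h then ∏ i ∈ Finset.range (n+1), V i (hgt c s i) else 0)
      = mu V c n h := by
  induction n generalizing h with
  | zero =>
    simp only [mu]
    simp [hgt_zero, eq_comm]
  | succ n ih =>
    rw [← (Fin.snocEquiv (fun _ : Fin (n+1) => Bool)).sum_comp, Fintype.sum_prod_type]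
    simp only [Fin.snocEquiv, Equiv.coe_fn_mk, Fintype.sum_bool, hgt_snoc_last, if_true, Bool.false_eq_true, if_false]
    rw [mu, ← ih, ← ih, mul_add, Finset.mul_sum, Finset.mul_sum]
    congr 1
    · apply Finset.sum_congr rfl
      intro s _
      have e : (hgt c s n + (1) = h) ↔ hgt c s n = h - 1 := by
        omega
      have e' : hgt c s n = h - 1 → hgt c (Fin.snoc s true : Fin (n+1) → Bool) (n+1) = h := by
        intro h1; rw [hgt_snoc_last]; simp; omega
      by_cases hh : hgt c s n = h - 1
      · rw [if_pos (e.2 hh), if_pos hh, Finset.prod_range_succ, e' hh, mul_comm]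
        congr 1
        apply Finset.prod_congr rfl
        intro i hi
        rw [hgt_snoc]
        have := Finset.mem_range.1 hi
        omega
      · rw [if_neg (fun h' => hh (e.1 h')), if_neg hh, mul_zero]
    · apply Finset.sum_congr rfl
      intro s _
      have e : (hgt c s n + (-1) = h) ↔ hgt c s n = h + 1 := by
        omega
      have e' : hgt c s n = h + 1 → hgt c (Fin.snoc s false : Fin (n+1) → Bool) (n+1) = h := by
        intro h1; rw [hgt_snoc_last]; simp; omega
      by_cases hh : hgt c s n = h + 1
      · rw [if_pos (e.2 hh), if_pos hh, Finset.prod_range_succ, e' hh, mul_comm]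
        congr 1
        apply Finset.prod_congr rfl
        intro i hi
        rw [hgt_snoc]
        have := Finset.mem_range.1 hi
        omega
      · rw [if_neg (fun h' => hh (e.1 h')), if_neg hh, mul_zero]

/-- site weight -/
noncomputable def wt (a : ℝ) (h : ℤ) : ℝ := if h = 0 then a else 1

theorem wt_pos {a : ℝ} (ha : 0 < a) (h : ℤ) : 0 < wt a h := by
  unfold wt; split_ifs <;> simp [ha]

theorem prod_wt {n : ℕ} (a : ℝ) (c : ℤ) (s : Fin n → Bool) :
    ∏ i ∈ Finset.range (n+1), wt a (hgt c s i) = a ^ visits c s := by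
  unfold wt visits
  rw [Finset.prod_ite]
  simp

theorem prod_mid {n : ℕ} (y : ℝ) (c : ℤ) (s : Fin n → Bool) :
    ∏ i ∈ Finset.range (n+1), (if i = n / 2 then y ^ (hgt c s i) else 1) = y ^ (hgt c s (n/2)) := by
  rw [Finset.prod_ite_eq']
  rw [if_pos (Finset.mem_range.2 (by omega))]

theorem hgt_lip {n : ℕ} (c : ℤ) (s : Fin n → Bool) (i d : ℕ) :
    hgt c s (i+d) ≤ hgt c s i + d ∧ hgt c s i ≤ hgt c s (i+d) + d := by
  induction d with
  | zero => simp
  | succ d ih =>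
    rw [← add_assoc, hgt_succ]
    push_cast
    split_ifs <;> constructor <;> omega

/-- weighted sum over paths from `c` to `c'` satisfying the site conditions `Q`. -/
theorem pathsum_cond (Q : ℕ → ℤ → Prop) (w : ℕ → ℤ → ℝ) (c : ℤ) (n : ℕ) (h : ℤ) :
    ∑ s : Fin n → Bool, (if hgt c s n = h ∧ ∀ i ≤ n, Q i (hgt c s i) then
      ∏ i ∈ Finset.range (n+1), w i (hgt c s i) else 0)
      = mu (fun i h => if Q i h then w i h else 0) c n h := by
  rw [← pathsum]
  apply Finset.sum_congr rfl
  intro s _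
  rw [Finset.prod_ite_zero]
  have : (∀ i ∈ Finset.range (n+1), Q i (hgt c s i)) ↔ ∀ i ≤ n, Q i (hgt c s i) := by
    simp
  simp only [this]
  split_ifs <;> simp_all

/-! ### Analytic parts -/

/-- lower path decay parameter -/
noncomputable def lamb (a : ℝ) : ℝ := if a ≤ 2 then 1 else (Real.sqrt (a-1))⁻¹
/-- lower path growth rate -/
noncomputable def grA (a : ℝ) : ℝ := lamb a + (lamb a)⁻¹
/-- upper path tilt -/
noncomputable def tilt (y : ℝ) : ℝ := if y ≤ 1 then 1 else Real.sqrt y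
/-- upper path growth rate -/
noncomputable def grB (y : ℝ) : ℝ := tilt y + (tilt y)⁻¹

theorem lamb_pos (a : ℝ) : 0 < lamb a := by
  unfold lamb; split_ifs with h
  · norm_num
  · have : 0 < a - 1 := by linarith
    positivity

theorem lamb_le_one (a : ℝ) : lamb a ≤ 1 := by
  unfold lamb; split_ifs with h
  · norm_num
  · apply inv_le_one_of_one_le₀
    rw [Real.one_le_sqrt]; linarith

theorem grA_pos (a : ℝ) : 0 < grA a := by
  have := lamb_pos a
  unfold grA; positivity

theorem tilt_ge_one (y : ℝ) : 1 ≤ tilt y := by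
  unfold tilt; split_ifs with h
  · norm_num
  · rw [Real.one_le_sqrt]; linarith

theorem tilt_pos (y : ℝ) : 0 < tilt y := lt_of_lt_of_le one_pos (tilt_ge_one y)

theorem grB_pos (y : ℝ) : 0 < grB y := by
  have := tilt_pos y
  unfold grB; positivity

theorem log_sqrt_add_inv (z : ℝ) (hz : 0 < z) :
    Real.log (Real.sqrt z + (Real.sqrt z)⁻¹) = Real.log (z+1) - (1/2) * Real.log z := by
  have h1 : 0 < Real.sqrt z := Real.sqrt_pos.2 hz
  have : Real.sqrt z + (Real.sqrt z)⁻¹ = (z+1) / Real.sqrt z := by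
    field_simp
    rw [Real.sq_sqrt hz.le]
  rw [this, Real.log_div (by positivity) (by positivity), Real.log_sqrt hz.le]
  ring

theorem psiGval_eq (a y : ℝ) : psiGval a y = (Real.log (grA a) + Real.log (grB y)) / 2 := by
  have e2 : (1:ℝ) + 1 = 2 := by norm_num
  unfold psiGval grA grB lamb tilt
  split_ifs with h1 h2 h2
  · simp only [inv_one, e2]; ring
  · rw [log_sqrt_add_inv y (by linarith)]
    simp only [inv_one, e2]; ring
  · rw [inv_inv, add_comm (Real.sqrt (a-1))⁻¹, log_sqrt_add_inv (a-1) (by linarith)]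
    simp only [inv_one, e2, sub_add_cancel]; ring
  · rw [inv_inv, add_comm (Real.sqrt (a-1))⁻¹, log_sqrt_add_inv (a-1) (by linarith),
      log_sqrt_add_inv y (by linarith)]
    simp only [sub_add_cancel]; ring

theorem lamb_zero (a : ℝ) : a * lamb a ≤ grA a := by
  unfold grA lamb
  split_ifs with h
  · norm_num; linarith
  · have h0 : 0 < a - 1 := by linarith
    have h1 : 0 < Real.sqrt (a-1) := Real.sqrt_pos.2 h0
    have h2 := Real.sq_sqrt h0.le
    rw [inv_inv]
    apply le_of_eq
    field_simp
    linarith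

/-- supersolution bound for lower paths -/
theorem low_upper (a : ℝ) (ha : 0 < a) (c : ℤ) (hc : 0 < c) (i : ℕ) (h : ℤ) :
    mu (fun _ h => if 0 ≤ h then wt a h else 0) c i h
      ≤ (lamb a)^(-c) * grA a ^ i * (if 0 ≤ h then (lamb a)^h else 0) := by
  have hl := lamb_pos a
  have hA := grA_pos a
  induction i generalizing h with
  | zero =>
    simp only [mu]
    by_cases e : h = c
    · subst e
      rw [if_pos rfl, if_pos hc.le, if_pos hc.le, wt, if_neg hc.ne']
      rw [pow_zero, mul_one, ← zpow_add₀ hl.ne']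
      simp
    · rw [if_neg e]; split_ifs <;> positivity
  | succ i ih =>
    simp only [mu]
    by_cases hh : 0 ≤ h
    · rw [if_pos hh, if_pos hh]
      have h1 := ih (h-1)
      have h2 := ih (h+1)
      rw [if_pos (by omega : (0:ℤ) ≤ h + 1)] at h2
      have hw := wt_pos ha h
      refine (mul_le_mul_of_nonneg_left (add_le_add h1 h2) hw.le).trans ?_
      set K := (lamb a)^(-c) * grA a ^ i with hK
      have hKp : 0 < K := by positivity
      have key : wt a h * ((if 0 ≤ h - 1 then (lamb a)^(h-1) else 0) + (lamb a)^(h+1))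
          ≤ grA a * (lamb a)^h := by
        by_cases h0 : h = 0
        · subst h0
          have := lamb_zero a
          simpa [wt] using this
        · rw [if_pos (by omega), wt, if_neg h0, zpow_sub_one₀ hl.ne', zpow_add_one₀ hl.ne']
          apply le_of_eq
          unfold grA
          ring
      calc _ = K * (wt a h * ((if 0 ≤ h - 1 then (lamb a)^(h-1) else 0) + (lamb a)^(h+1))) := by ring
        _ ≤ K * (grA a * (lamb a)^h) := mul_le_mul_of_nonneg_left key hKp.le
        _ = _ := by rw [hK, pow_succ]; ring
    · rw [if_neg hh, if_neg hh]; simp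

/-- supersolution bound for upper paths -/
theorem up_upper (y : ℝ) (hy : 0 < y) (c : ℤ) (mid i : ℕ) (h : ℤ) :
    mu (fun i h => if 0 ≤ h then (if i = mid then y ^ h else 1) else 0) c i h
      ≤ grB y ^ i * (if i < mid then (tilt y)^(c-h) else (tilt y)^(c+h)) := by
  have hl := tilt_pos y
  have hB := grB_pos y
  have hyt : ∀ h : ℤ, 0 ≤ h → y ^ h ≤ tilt y ^ (2*h) := by
    intro h hh
    unfold tilt
    split_ifs with h1
    · rw [one_zpow]
      lift h to ℕ using hh
      rw [zpow_natCast]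
      exact pow_le_one₀ hy.le h1
    · rw [zpow_mul]
      have : Real.sqrt y ^ (2:ℤ) = y := by
        rw [show (2:ℤ) = ((2:ℕ):ℤ) from rfl, zpow_natCast, Real.sq_sqrt hy.le]
      rw [this]
  have e1 : ∀ h : ℤ, tilt y ^ (c-(h-1)) + tilt y ^ (c-(h+1)) = grB y * tilt y ^ (c-h) := by
    intro h
    rw [show c-(h-1) = (c-h)+1 by ring, show c-(h+1) = (c-h)-1 by ring,
      zpow_sub_one₀ hl.ne', zpow_add_one₀ hl.ne', grB]; ring
  have e2 : ∀ h : ℤ, tilt y ^ (c+(h-1)) + tilt y ^ (c+(h+1)) = grB y * tilt y ^ (c+h) := by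
    intro h
    rw [show c+(h-1) = (c+h)-1 by ring, show c+(h+1) = (c+h)+1 by ring,
      zpow_sub_one₀ hl.ne', zpow_add_one₀ hl.ne', grB]; ring
  have emid : ∀ h : ℤ, 0 ≤ h → y^h * tilt y ^ (c-h) ≤ tilt y ^ (c+h) := by
    intro h hh
    calc _ ≤ tilt y ^ (2*h) * tilt y ^ (c-h) :=
          mul_le_mul_of_nonneg_right (hyt h hh) (by positivity)
      _ = _ := by rw [← zpow_add₀ hl.ne']; congr 1; ring
  induction i generalizing h with
  | zero =>
    simp only [mu]
    by_cases e : h = c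
    · subst e
      rw [if_pos rfl]
      by_cases hh : 0 ≤ h
      · rw [if_pos hh]
        by_cases hm : 0 = mid
        · rw [if_pos hm, if_neg (by omega)]
          have := emid h hh
          simpa using this
        · rw [if_neg hm, if_pos (by omega)]
          simp
      · rw [if_neg hh]; split_ifs <;> positivity
    · rw [if_neg e]; split_ifs <;> positivity
  | succ i ih =>
    simp only [mu]
    by_cases hh : 0 ≤ h
    swap
    · rw [if_neg hh, zero_mul]; split_ifs <;> positivity
    rw [if_pos hh]
    have h1 := ih (h-1)
    have h2 := ih (h+1)
    by_cases hm : i < mid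
    · rw [if_pos hm] at h1 h2
      have h3 := add_le_add h1 h2
      rw [← mul_add, e1] at h3
      by_cases hm2 : i + 1 = mid
      · rw [if_pos hm2, if_neg (by omega)]
        calc _ ≤ y^h * (grB y ^ i * (grB y * tilt y ^ (c-h))) :=
              mul_le_mul_of_nonneg_left h3 (by positivity)
          _ = grB y ^ (i+1) * (y^h * tilt y ^ (c-h)) := by rw [pow_succ]; ring
          _ ≤ _ := mul_le_mul_of_nonneg_left (emid h hh) (by positivity)
      · rw [if_neg hm2, if_pos (by omega), one_mul]
        refine h3.trans (le_of_eq ?_)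
        rw [pow_succ]; ring
    · rw [if_neg hm] at h1 h2
      have h3 := add_le_add h1 h2
      rw [← mul_add, e2] at h3
      rw [if_neg (by omega), if_neg (by omega), one_mul]
      refine h3.trans (le_of_eq ?_)
      rw [pow_succ]; ring

/-! ### Subsolutions for the lower path -/

theorem grA_gt_two {a : ℝ} (h : 2 < a) : 2 < grA a := by
  have h0 : 0 < a - 1 := by linarith
  have h1 : 1 < Real.sqrt (a-1) := by
    rw [Real.lt_sqrt (by norm_num)]; linarith
  unfold grA lamb
  rw [if_neg (by linarith), inv_inv]
  set s := Real.sqrt (a-1)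
  have : s⁻¹ + s - 2 = (s-1)^2 / s := by field_simp; ring
  have : 0 < s⁻¹ + s - 2 := by
    rw [this]
    have : 0 < s - 1 := by linarith
    positivity
  linarith

theorem subsol_flat (a θ : ℝ) (ha : 0 < a) (hθ : 0 < θ) (h2 : θ < 2) :
    ∃ (L : ℕ) (φ : ℤ → ℝ), 2 ≤ L ∧ 0 < φ 1 ∧ (∀ h, 0 ≤ φ h) ∧ (∀ h, φ h ≤ 1) ∧
      (∀ h, (h < 0 ∨ (L:ℤ) < h) → φ h = 0) ∧
      ∀ h : ℤ, 0 ≤ h → h ≤ L → θ * φ h ≤ wt a h * (φ (h-1) + φ (h+1)) := by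
  obtain ⟨L, hL⟩ := exists_nat_ge (2 / (2-θ) + 2)
  have h2θ : 0 < 2 - θ := by linarith
  have hd : 0 < 2 / (2-θ) := by positivity
  have hL2 : (2:ℝ) ≤ L := by linarith
  have hL0 : (0:ℝ) < L := by linarith
  have hLn : 2 ≤ L := by exact_mod_cast hL2
  have hLk : 2 ≤ (2-θ) * ((L:ℝ)-1) := by
    have : 2/(2-θ) ≤ (L:ℝ) - 1 := by linarith
    rw [div_le_iff₀ h2θ] at this
    linarith
  let φ : ℤ → ℝ := fun h => if 0 ≤ h ∧ h ≤ L then (h:ℝ) * ((L:ℝ) - h) / (L:ℝ)^2 else 0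
  have hφ0 : ∀ h, 0 ≤ φ h := by
    intro h
    simp only [φ]
    split_ifs with hh
    · have h1 : (0:ℝ) ≤ h := by exact_mod_cast hh.1
      have h2 : (h:ℝ) ≤ L := by exact_mod_cast hh.2
      have : 0 ≤ (L:ℝ) - h := by linarith
      positivity
    · exact le_rfl
  refine ⟨L, φ, hLn, ?_, hφ0, ?_, ?_, ?_⟩
  · simp only [φ]
    rw [if_pos ⟨by norm_num, by omega⟩]
    have : (0:ℝ) < (L:ℝ) - ((1:ℤ):ℝ) := by push_cast; linarith
    push_cast at this ⊢
    positivity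
  · intro h
    simp only [φ]
    split_ifs with hh
    · have h1 : (0:ℝ) ≤ h := by exact_mod_cast hh.1
      have h2 : (h:ℝ) ≤ L := by exact_mod_cast hh.2
      rw [div_le_one (by positivity)]
      nlinarith
    · norm_num
  · intro h hh
    simp only [φ]
    rw [if_neg (by omega)]
  · intro h h0 hl
    have hwp := wt_pos ha h
    by_cases e : h = 0 ∨ h = L
    · have : φ h = 0 := by
        simp only [φ]
        rw [if_pos ⟨h0, hl⟩]
        rcases e with rfl | rfl <;> simp
      rw [this, mul_zero]
      exact mul_nonneg hwp.le (add_nonneg (hφ0 _) (hφ0 _))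
    · push Not at e
      have g1 : (1:ℝ) ≤ h := by exact_mod_cast (by omega : 1 ≤ h)
      have g2 : (h:ℝ) ≤ L - 1 := by
        have : h + 1 ≤ (L:ℤ) := by omega
        have : (h:ℝ) + 1 ≤ L := by exact_mod_cast this
        linarith
      rw [wt, if_neg e.1, one_mul]
      simp only [φ]
      rw [if_pos ⟨h0, hl⟩, if_pos (by omega), if_pos (by omega), ← add_div, ← mul_div_assoc]
      apply div_le_div_of_nonneg_right _ (by positivity)
      push_cast
      have : (L:ℝ) - 1 ≤ h * (L - h) := by nlinarith
      nlinarith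

theorem subsol (a θ : ℝ) (ha : 0 < a) (hθ : 0 < θ) (hA : θ < grA a) :
    ∃ (L : ℕ) (φ : ℤ → ℝ), 2 ≤ L ∧ 0 < φ 1 ∧ (∀ h, 0 ≤ φ h) ∧ (∀ h, φ h ≤ 1) ∧
      (∀ h, (h < 0 ∨ (L:ℤ) < h) → φ h = 0) ∧
      ∀ h : ℤ, 0 ≤ h → h ≤ L → θ * φ h ≤ wt a h * (φ (h-1) + φ (h+1)) := by
  by_cases ha2 : a ≤ 2
  · apply subsol_flat a θ ha hθ
    simp only [grA, lamb, if_pos ha2] at hA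
    norm_num at hA
    exact hA
  push Not at ha2
  have hl := lamb_pos a
  have hl1 : lamb a < 1 := by
    unfold lamb
    rw [if_neg (by linarith)]
    apply inv_lt_one_of_one_lt₀
    rw [Real.lt_sqrt (by norm_num)]; linarith
  have hal : a * lamb a = grA a := by
    have h0 : 0 < a - 1 := by linarith
    have h1 : 0 < Real.sqrt (a-1) := Real.sqrt_pos.2 h0
    have h2 := Real.sq_sqrt h0.le
    unfold grA lamb
    rw [if_neg (by linarith), inv_inv]
    field_simp
    linarith
  set lam := lamb a with hlam
  set T := max θ 2 with hT
  have hTA : T < grA a := max_lt hA (grA_gt_two ha2)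
  have hT2 : 2 ≤ T := le_max_right _ _
  have hθT : θ ≤ T := le_max_left _ _
  obtain ⟨δ, hδ0, hδl, hδ⟩ : ∃ δ : ℝ, 0 < δ ∧ δ < lam ∧ δ * a ≤ grA a - T := by
    refine ⟨min (lam/2) ((grA a - T)/a), ?_, ?_, ?_⟩
    · apply lt_min (by positivity)
      apply div_pos (by linarith) ha
    · exact lt_of_le_of_lt (min_le_left _ _) (by linarith)
    · calc _ ≤ ((grA a - T)/a) * a := mul_le_mul_of_nonneg_right (min_le_right _ _) ha.le
        _ = _ := by field_simp
  obtain ⟨L0, hL0⟩ := exists_pow_lt_of_lt_one hδ0 hl1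
  let φ : ℤ → ℝ := fun h => if 0 ≤ h then max (lam ^ h - δ) 0 else 0
  have hφ0 : ∀ h, 0 ≤ φ h := by
    intro h
    simp only [φ]
    split_ifs
    · exact le_max_right _ _
    · exact le_rfl
  have hφge : ∀ h, 0 ≤ h → lam ^ h - δ ≤ φ h := by
    intro h hh
    simp only [φ]
    rw [if_pos hh]
    exact le_max_left _ _
  refine ⟨L0 + 2, φ, by omega, ?_, hφ0, ?_, ?_, ?_⟩
  · have := hφge 1 (by norm_num)
    rw [zpow_one] at this
    linarith
  · intro h
    simp only [φ]
    split_ifs with hh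
    · apply max_le _ (by norm_num)
      lift h to ℕ using hh
      rw [zpow_natCast]
      have := pow_le_one₀ (n := h) hl.le hl1.le
      linarith
    · norm_num
  · intro h hh
    simp only [φ]
    split_ifs with h0
    · apply max_eq_right
      lift h to ℕ using h0
      rw [zpow_natCast]
      have : lam ^ h ≤ lam ^ L0 := pow_le_pow_of_le_one hl.le hl1.le (by omega)
      linarith
    · rfl
  · intro h h0 hl'
    have hwp := wt_pos ha h
    have hnn : 0 ≤ wt a h * (φ (h-1) + φ (h+1)) :=
      mul_nonneg hwp.le (add_nonneg (hφ0 _) (hφ0 _))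
    refine (mul_le_mul_of_nonneg_right hθT (hφ0 h)).trans ?_
    have hcase : φ h = max (lam ^ h - δ) 0 := by simp only [φ]; rw [if_pos h0]
    rcases le_total (lam ^ h - δ) 0 with hc | hc
    · rw [hcase, max_eq_right hc, mul_zero]; exact hnn
    rw [hcase, max_eq_left hc]
    by_cases e : h = 0
    · subst e
      rw [wt, if_pos rfl, zpow_zero]
      have h1 := hφge (0+1) (by norm_num)
      have h2 := hφ0 (0-1)
      rw [zero_add, zpow_one] at h1
      calc T * (1 - δ) ≤ a * (lam - δ) := by nlinarith
        _ ≤ _ := by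
          apply mul_le_mul_of_nonneg_left _ ha.le
          simp only [zero_add]
          linarith
    · rw [wt, if_neg e, one_mul]
      have h1 := hφge (h+1) (by omega)
      have h2 := hφge (h-1) (by omega)
      rw [zpow_add_one₀ hl.ne'] at h1
      rw [zpow_sub_one₀ hl.ne'] at h2
      have h3 : lam ^ h * lam + lam ^ h * lam⁻¹ = grA a * lam ^ h := by
        rw [grA]; ring
      have hp : 0 < lam ^ h := by positivity
      nlinarith

theorem loop_lemma (a θ : ℝ) (ha : 0 < a) (hθ : 0 < θ) (hA : θ < grA a) :
    ∃ (L : ℕ) (κ : ℝ), 2 ≤ L ∧ 0 < κ ∧ ∀ (m : ℕ) (f : ℕ → ℤ → ℝ), L + 2 ≤ m → m % 2 = 0 →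
      (∀ j h, 0 ≤ f j h) →
      (∀ j, j + 1 < m → ∀ h : ℤ, 0 ≤ h → h ≤ L →
        wt a h * (f j (h-1) + f j (h+1)) ≤ f (j+1) h) →
      a * f (m-1) 1 ≤ f m 0 → κ * θ ^ m * f 0 0 ≤ f m 0 := by
  obtain ⟨L, φ, hL, hφ1, hφ0, hφle, hφs, hφ⟩ := subsol a θ ha hθ hA
  set b := min a 1 with hb
  have hb0 : 0 < b := lt_min ha one_pos
  have hbw : ∀ h, b ≤ wt a h := by
    intro h; unfold wt; split_ifs
    · exact min_le_left _ _
    · exact min_le_right _ _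
  refine ⟨L, a * b ^ L * φ 1 / θ ^ (L+1), hL, by positivity, ?_⟩
  intro m f hm hm2 hf hstep hlast
  have hf0 := hf 0 0
  have s1 : ∀ j, j < m → ∀ h : ℤ, 0 ≤ h → h ≤ L → h ≤ j → (h - j) % 2 = 0 →
      b ^ j * f 0 0 ≤ f j h := by
    intro j
    induction j with
    | zero =>
      intro _ h h0 _ h2 _
      have : h = 0 := by push_cast at h2; omega
      subst this
      simp
    | succ j ih =>
      intro hj h h0 h1 h2 h3
      push_cast at h2 h3
      refine le_trans ?_ (hstep j (by omega) h h0 h1)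
      rw [pow_succ]
      have key : b ^ j * f 0 0 ≤ f j (h-1) + f j (h+1) := by
        by_cases e : h = 0
        · subst e
          have := ih (by omega) 1 (by omega) (by omega) (by omega) (by omega)
          have h5 := hf j (0-1)
          simp only [zero_add]
          linarith
        · have := ih (by omega) (h-1) (by omega) (by omega) (by omega) (by omega)
          have h5 := hf j (h+1)
          linarith
      calc b ^ j * b * f 0 0 = b * (b^j * f 0 0) := by ring
        _ ≤ wt a h * (f j (h-1) + f j (h+1)) :=
          mul_le_mul (hbw h) key (by positivity) (wt_pos ha h).le
  have s2 : ∀ i, L + i < m → ∀ h : ℤ, (h - (L + i)) % 2 = 0 →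
      b ^ L * f 0 0 * θ ^ i * φ h ≤ f (L+i) h := by
    intro i
    induction i with
    | zero =>
      intro hi h hp
      by_cases hh : h < 0 ∨ (L:ℤ) < h
      · rw [hφs h hh, mul_zero]; exact hf _ _
      · have := s1 L (by omega) h (by omega) (by omega) (by omega) (by push_cast at hp; omega)
        rw [pow_zero, mul_one, add_zero]
        have h6 : 0 ≤ b ^ L * f 0 0 := by positivity
        nlinarith [hφle h]
    | succ i ih =>
      intro hi h hp
      push_cast at hp
      by_cases hh : h < 0 ∨ (L:ℤ) < h
      · rw [hφs h hh, mul_zero]; exact hf _ _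
      · have e := hstep (L+i) (by omega) h (by omega) (by omega)
        have h1 := ih (by omega) (h-1) (by omega)
        have h2 := ih (by omega) (h+1) (by omega)
        have h3 := hφ h (by omega) (by omega)
        have hw := wt_pos ha h
        rw [← add_assoc]
        refine le_trans ?_ e
        calc b ^ L * f 0 0 * θ ^ (i+1) * φ h = (b ^ L * f 0 0 * θ ^ i) * (θ * φ h) := by
              rw [pow_succ]; ring
          _ ≤ (b ^ L * f 0 0 * θ ^ i) * (wt a h * (φ (h-1) + φ (h+1))) :=
              mul_le_mul_of_nonneg_left h3 (by positivity)
          _ = wt a h * (b ^ L * f 0 0 * θ ^ i * φ (h-1) + b ^ L * f 0 0 * θ ^ i * φ (h+1)) := by ring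
          _ ≤ _ := mul_le_mul_of_nonneg_left (add_le_add h1 h2) hw.le
  obtain ⟨i, rfl⟩ : ∃ i, m = L + i + 1 := ⟨m - L - 1, by omega⟩
  have h7 := s2 i (by omega) 1 (by omega)
  rw [show L + i + 1 - 1 = L + i by omega] at hlast
  refine le_trans ?_ hlast
  calc _ = a * (b ^ L * f 0 0 * θ ^ i * φ 1) := by
        rw [show L + i + 1 = (L + 1) + i by ring, pow_add θ (L+1) i]
        have : θ ^ (L+1) ≠ 0 := by positivity
        field_simp
    _ ≤ _ := mul_le_mul_of_nonneg_left h7 ha.le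

/-! ### Lower bound for the lower path -/

theorem pow_shift (θ : ℝ) (hθ : 0 < θ) (n m r R : ℕ) (h : n = m + r) (hr : r ≤ R) :
    θ ^ n / (max 1 θ) ^ R ≤ θ ^ m := by
  have h1 : (1:ℝ) ≤ max 1 θ := le_max_left _ _
  have h2 : θ ≤ max 1 θ := le_max_right _ _
  rw [div_le_iff₀ (by positivity), h, pow_add]
  apply mul_le_mul_of_nonneg_left _ (by positivity)
  exact (pow_le_pow_left₀ hθ.le h2 r).trans (pow_le_pow_right₀ h1 hr)

/-- site conditions for the lower path -/
def QL (L : ℕ) (c c' : ℕ) (n : ℕ) (i : ℕ) (h : ℤ) : Prop :=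
  0 ≤ h ∧ h ≤ L ∧ (i = 1 → h = c - 1) ∧ (i + 1 = n → h = c' - 1) ∧ (i = n / 2 → h = 0)

theorem low_lower (a θ : ℝ) (ha : 0 < a) (hθ : 0 < θ) (hA : θ < grA a) :
    ∃ (L : ℕ) (κ : ℝ) (N : ℕ), 2 ≤ L ∧ 0 < κ ∧ ∀ n, N ≤ n → ∀ c c' : ℕ,
      (c = 1 ∨ c = 2) → (c' = 1 ∨ c' = 2) → (n / 2 - c) % 2 = 0 → (n - n / 2 - c') % 2 = 0 →
      κ * θ ^ n ≤ mu (fun i h => if QL L c c' n i h then wt a h else 0) c n c' := by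
  obtain ⟨L, κ, hL, hκ, hloop⟩ := loop_lemma a θ ha hθ hA
  refine ⟨L, κ * κ * a / (max 1 θ) ^ 4, 2 * L + 20, hL, ?_, ?_⟩
  · have h1 : (1:ℝ) ≤ max 1 θ := le_max_left _ _
    positivity
  intro n hn c c' hc hc' hpar hpar'
  set V : ℕ → ℤ → ℝ := fun i h => if QL L c c' n i h then wt a h else 0 with hV
  have hVn : ∀ i h, 0 ≤ V i h := by
    intro i h; simp only [hV]; split_ifs
    · exact (wt_pos ha h).le
    · exact le_rfl
  set f := mu V c with hf
  have hf0 : ∀ i h, 0 ≤ f i h := mu_nonneg V c hVn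
  have hstep : ∀ i h, QL L c c' n (i+1) h → f (i+1) h = wt a h * (f i (h-1) + f i (h+1)) := by
    intro i h hq
    simp only [hf, mu, hV]
    rw [if_pos hq]
  have start : f 0 c = 1 := by
    simp only [hf, mu, hV, if_true]
    rw [if_pos, wt, if_neg (by omega)]
    refine ⟨by omega, by omega, by omega, by omega, by omega⟩
  have hup1 : ∀ i h, h ≠ 0 → QL L c c' n (i+1) h → f i (h-1) ≤ f (i+1) h := by
    intro i h h0 hq
    rw [hstep i h hq, wt, if_neg h0, one_mul]
    linarith [hf0 i (h+1)]
  have hdown1 : ∀ i h, h ≠ 0 → QL L c c' n (i+1) h → f i (h+1) ≤ f (i+1) h := by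
    intro i h h0 hq
    rw [hstep i h hq, wt, if_neg h0, one_mul]
    linarith [hf0 i (h-1)]
  have hdown0 : ∀ i, QL L c c' n (i+1) 0 → a * f i 1 ≤ f (i+1) 0 := by
    intro i hq
    rw [hstep i 0 hq, wt, if_pos rfl, zero_add]
    apply mul_le_mul_of_nonneg_left _ ha.le
    linarith [hf0 i (0-1)]
  have first : a ≤ f c 0 := by
    rcases hc with rfl | rfl
    · have := hdown0 0 ⟨by omega, by omega, by omega, by omega, by omega⟩
      simp only [Nat.cast_one] at start
      rw [start] at this
      simpa using this
    · have h1 := hdown1 0 1 (by norm_num) ⟨by omega, by omega, by omega, by omega, by omega⟩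
      have h2 := hdown0 1 ⟨by omega, by omega, by omega, by omega, by omega⟩
      have e : (1:ℤ) + 1 = ((2:ℕ):ℤ) := by norm_num
      rw [e, start] at h1
      simp only [zero_add] at h1 h2
      have : f 2 0 = f (1+1) 0 := rfl
      rw [this]
      nlinarith
  have half1 : κ * θ ^ (n/2 - c) * f c 0 ≤ f (n/2) 0 := by
    have := hloop (n/2 - c) (fun j => f (c + j)) (by omega) hpar (fun j h => hf0 _ h) ?_ ?_
    · simp only [add_zero] at this
      rwa [show c + (n/2 - c) = n/2 by omega] at this
    · intro j hj h h0 h1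
      exact (hstep (c+j) h ⟨h0, h1, by omega, by omega, by omega⟩).ge
    · have := hdown0 (c + (n/2-c-1)) ⟨by omega, by omega, by omega, by omega, by omega⟩
      rwa [show c + (n/2-c-1) + 1 = c + (n/2-c) by omega] at this
  have half2 : κ * θ ^ (n - n/2 - c') * f (n/2) 0 ≤ f (n-c') 0 := by
    have := hloop (n - n/2 - c') (fun j => f (n/2 + j)) (by omega) hpar' (fun j h => hf0 _ h) ?_ ?_
    · simp only [add_zero] at this
      rwa [show n/2 + (n - n/2 - c') = n - c' by omega] at this
    · intro j hj h h0 h1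
      exact (hstep (n/2+j) h ⟨h0, h1, by omega, by omega, by omega⟩).ge
    · have := hdown0 (n/2 + (n - n/2-c'-1)) ⟨by omega, by omega, by omega, by omega, by omega⟩
      rwa [show n/2 + (n - n/2-c'-1) + 1 = n/2 + (n - n/2-c') by omega] at this
  have last : f (n-c') 0 ≤ f n c' := by
    rcases hc' with rfl | rfl
    · have := hup1 (n-1) 1 (by norm_num) ⟨by omega, by omega, by omega, by omega, by omega⟩
      rw [show n - 1 + 1 = n by omega] at this
      simpa using this
    · have h1 := hup1 (n-2) 1 (by norm_num) ⟨by omega, by omega, by omega, by omega, by omega⟩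
      have h2 := hup1 (n-1) 2 (by norm_num) ⟨by omega, by omega, by omega, by omega, by omega⟩
      rw [show n - 1 + 1 = n by omega] at h2
      rw [show n - 2 + 1 = n - 1 by omega] at h1
      norm_num at h1 h2
      exact h1.trans h2
  have hp := pow_shift θ hθ n ((n/2 - c) + (n - n/2 - c')) (c + c') 4 (by omega) (by omega)
  calc κ * κ * a / (max 1 θ) ^ 4 * θ ^ n = κ * κ * a * (θ ^ n / (max 1 θ) ^ 4) := by ring
    _ ≤ κ * κ * a * θ ^ ((n/2 - c) + (n - n/2 - c')) :=
      mul_le_mul_of_nonneg_left hp (by positivity)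
    _ = κ * θ ^ (n - n/2 - c') * (κ * θ ^ (n/2 - c) * a) := by rw [pow_add]; ring
    _ ≤ κ * θ ^ (n - n/2 - c') * (κ * θ ^ (n/2 - c) * f c 0) := by gcongr
    _ ≤ κ * θ ^ (n - n/2 - c') * f (n/2) 0 := by gcongr
    _ ≤ _ := half2.trans last

/-! ### Lower bound for the upper path -/

theorem exists_block (y θ : ℝ) (hy : 0 < y) (hθ : 0 < θ) (hB : θ < grB y) :
    ∃ ℓ k : ℕ, 0 < ℓ ∧ k ≤ ℓ ∧ ℓ ≤ 2 * k ∧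
      θ ^ (2 * ℓ) ≤ (ℓ.choose k : ℝ) ^ 2 * y ^ (2 * (k:ℤ) - ℓ) := by
  have hBp := grB_pos y
  set r := (θ / grB y) ^ 2 with hr
  have hr0 : 0 < r := by positivity
  have hr1 : r < 1 := by
    have : θ / grB y < 1 := by rw [div_lt_one hBp]; exact hB
    rw [hr]
    exact pow_lt_one₀ (by positivity) this (by norm_num)
  have ht := tendsto_pow_const_mul_const_pow_of_abs_lt_one 2 (r := r)
    (by rw [abs_of_pos hr0]; exact hr1)
  have hev := (ht.eventually (gt_mem_nhds (by norm_num : (0:ℝ) < 1/4)))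
  obtain ⟨N, hN⟩ := eventually_atTop.1 hev
  set ℓ := 2 * (N + 1) with hℓ
  have hN' := hN ℓ (by omega)
  have hℓ1 : (1:ℝ) ≤ ℓ := by exact_mod_cast (by omega : 1 ≤ ℓ)
  have hkey : ((ℓ:ℝ)+1)^2 * θ ^ (2*ℓ) ≤ grB y ^ (2*ℓ) := by
    have h1 : ((ℓ:ℝ)+1)^2 * r ^ ℓ ≤ 1 := by
      have : ((ℓ:ℝ)+1)^2 ≤ 4 * (ℓ:ℝ)^2 := by nlinarith
      have h3 : 0 < r ^ ℓ := by positivity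
      nlinarith
    have h2 : r ^ ℓ = θ ^ (2*ℓ) / grB y ^ (2*ℓ) := by
      rw [hr, ← pow_mul, div_pow]
    rw [h2, ← mul_div_assoc, div_le_one (by positivity)] at h1
    exact h1
  have hk2 : ∀ X : ℝ, grB y ^ (2*ℓ) ≤ ((ℓ:ℝ)+1)^2 * X → θ ^ (2*ℓ) ≤ X := by
    intro X hX
    have := hkey.trans hX
    exact le_of_mul_le_mul_left this (by positivity)
  by_cases hy1 : y ≤ 1
  · refine ⟨ℓ, N+1, by omega, by omega, by omega, ?_⟩
    apply hk2
    have e : (2 * ((N+1:ℕ):ℤ) - (ℓ:ℤ)) = 0 := by push_cast [hℓ]; ring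
    rw [e, zpow_zero, mul_one]
    have hg : grB y = 2 := by
      unfold grB tilt; rw [if_pos hy1]; norm_num
    have hc := Nat.four_pow_le_two_mul_self_mul_centralBinom (N+1) (by omega)
    rw [Nat.centralBinom_eq_two_mul_choose, ← hℓ] at hc
    have hc' : (4:ℝ)^(N+1) ≤ (ℓ:ℝ) * (ℓ.choose (N+1) : ℝ) := by
      exact_mod_cast hc
    have e4 : (2:ℝ) ^ (2*ℓ) = ((4:ℝ)^(N+1))^2 := by
      rw [show (4:ℝ) = 2^2 by norm_num, ← pow_mul, ← pow_mul]; congr 1; omega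
    rw [hg, e4, ← mul_pow]
    apply pow_le_pow_left₀ (by positivity)
    refine hc'.trans ?_
    gcongr
    linarith
  · push Not at hy1
    have hbin := add_pow y 1 ℓ
    obtain ⟨k0, hk0, hle⟩ : ∃ k ∈ Finset.range (ℓ+1),
        (y+1)^ℓ / ((ℓ:ℝ)+1) ≤ y^k * (ℓ.choose k : ℝ) := by
      apply Finset.exists_le_of_sum_le (by simp)
      rw [Finset.sum_const, Finset.card_range, nsmul_eq_mul]
      push_cast
      rw [mul_div_cancel₀ _ (by positivity), hbin]
      simp
    have hk0l : k0 ≤ ℓ := by have := Finset.mem_range.1 hk0; omega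
    obtain ⟨k, hkl, hlk, hle⟩ : ∃ k, k ≤ ℓ ∧ ℓ ≤ 2*k ∧
        (y+1)^ℓ / ((ℓ:ℝ)+1) ≤ y^k * (ℓ.choose k : ℝ) := by
      by_cases h : ℓ ≤ 2 * k0
      · exact ⟨k0, hk0l, h, hle⟩
      · refine ⟨ℓ - k0, by omega, by omega, hle.trans ?_⟩
        rw [Nat.choose_symm hk0l]
        apply mul_le_mul_of_nonneg_right _ (by positivity)
        exact pow_le_pow_right₀ hy1.le (by omega)
    refine ⟨ℓ, k, by omega, hkl, hlk, ?_⟩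
    apply hk2
    have hsq : grB y ^ 2 = (y+1)^2 / y := by
      have hs : 0 < Real.sqrt y := Real.sqrt_pos.2 hy
      have hs2 := Real.sq_sqrt hy.le
      unfold grB tilt; rw [if_neg (by linarith)]
      have : Real.sqrt y + (Real.sqrt y)⁻¹ = (y+1) / Real.sqrt y := by
        field_simp; linarith
      rw [this, div_pow, hs2]
    rw [pow_mul, hsq, div_pow, zpow_sub₀ hy.ne', zpow_natCast, zpow_mul]
    rw [div_le_iff₀ (by positivity)] at hle
    rw [← mul_div_assoc, ← mul_div_assoc]
    apply div_le_div_of_nonneg_right _ (by positivity)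
    have e5 : (y ^ (2:ℤ)) ^ (k:ℤ) = (y^k)^2 := by
      rw [zpow_natCast, show (2:ℤ) = ((2:ℕ):ℤ) from rfl, zpow_natCast, ← pow_mul, ← pow_mul, mul_comm]
    rw [e5]
    calc ((y+1)^2)^ℓ = ((y+1)^ℓ)^2 := by rw [← pow_mul, ← pow_mul, mul_comm]
      _ ≤ (y ^ k * (ℓ.choose k : ℝ) * ((ℓ:ℝ)+1))^2 := pow_le_pow_left₀ (by positivity) hle 2
      _ = _ := by ring

theorem block_step (g : ℕ → ℤ → ℝ) (hg : ∀ i h, 0 ≤ g i h) (ℓ : ℕ) (H h0 : ℤ)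
    (hstep : ∀ i < ℓ, ∀ h, H ≤ h → g i (h-1) + g i (h+1) ≤ g (i+1) h) (hH : H ≤ h0 - ℓ) :
    ∀ i ≤ ℓ, ∀ k : ℕ, (i.choose k : ℝ) * g 0 h0 ≤ g i (h0 - i + 2 * k) := by
  intro i
  induction i with
  | zero =>
    intro _ k
    cases k with
    | zero => simp
    | succ k => simp [hg]
  | succ i ih =>
    intro hi k
    refine le_trans ?_ (hstep i (by omega) _ (by push_cast; omega))
    cases k with
    | zero =>
      have := ih (by omega) 0
      have h2 := hg i (h0 - ((i+1:ℕ):ℤ) + 2 * ((0:ℕ):ℤ) - 1)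
      rw [show h0 - ((i+1:ℕ):ℤ) + 2 * ((0:ℕ):ℤ) + 1 = h0 - i + 2 * ((0:ℕ):ℤ) by push_cast; ring]
      simp only [Nat.choose_zero_right] at this ⊢
      linarith
    | succ k =>
      have h1 := ih (by omega) k
      have h2 := ih (by omega) (k+1)
      rw [show h0 - ((i+1:ℕ):ℤ) + 2 * ((k+1:ℕ):ℤ) + 1 = h0 - i + 2 * ((k+1:ℕ):ℤ) by push_cast; ring,
        show h0 - ((i+1:ℕ):ℤ) + 2 * ((k+1:ℕ):ℤ) - 1 = h0 - i + 2 * (k:ℤ) by push_cast; ring,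
        Nat.choose_succ_succ]
      push_cast at h1 h2 ⊢
      rw [add_mul]
      exact add_le_add h1 h2

theorem blocks (g : ℕ → ℤ → ℝ) (hg : ∀ i h, 0 ≤ g i h) (ℓ k : ℕ) (H h0 : ℤ) (J : ℕ)
    (hstep : ∀ i < J * ℓ, ∀ h, H ≤ h → g i (h-1) + g i (h+1) ≤ g (i+1) h)
    (hH : ∀ j < J, H ≤ h0 + j * (2 * (k:ℤ) - ℓ) - ℓ) :
    (ℓ.choose k : ℝ) ^ J * g 0 h0 ≤ g (J * ℓ) (h0 + J * (2 * (k:ℤ) - ℓ)) := by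
  induction J with
  | zero => simp
  | succ J ih =>
    have h1 := ih (fun i hi => hstep i (by rw [add_mul]; omega)) (fun j hj => hH j (by omega))
    have h2 := block_step (fun i => g (J*ℓ + i)) (fun i h => hg _ h) ℓ H
      (h0 + J * (2 * (k:ℤ) - ℓ))
      (fun i hi h hh => hstep (J*ℓ+i) (by rw [add_mul]; omega) h hh) (hH J (by omega)) ℓ le_rfl k
    simp only [add_zero] at h2
    rw [show (J+1)*ℓ = J*ℓ + ℓ by ring,
      show h0 + ((J+1:ℕ):ℤ) * (2 * (k:ℤ) - ℓ) = h0 + J * (2 * (k:ℤ) - ℓ) - ℓ + 2 * k by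
        push_cast; ring]
    refine le_trans ?_ h2
    rw [pow_succ]
    calc _ = (ℓ.choose k : ℝ) * ((ℓ.choose k : ℝ) ^ J * g 0 h0) := by ring
      _ ≤ _ := mul_le_mul_of_nonneg_left h1 (by positivity)

/-- site conditions for the upper path -/
def QU (L : ℕ) (c c' : ℕ) (n : ℕ) (i : ℕ) (h : ℤ) : Prop :=
  min ((L:ℤ)+1) (min ((c:ℤ)+i) ((c':ℤ)+n-i)) ≤ h

theorem up_lower (y θ : ℝ) (hy : 0 < y) (hθ : 0 < θ) (hB : θ < grB y) (L : ℕ) :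
    ∃ (κ : ℝ) (N : ℕ), 0 < κ ∧ ∀ n, N ≤ n → ∀ c c' : ℕ,
      (c = 1 ∨ c = 2) → (c' = 1 ∨ c' = 2) → (n + c + c') % 2 = 0 →
      κ * θ ^ n ≤ mu (fun i h => if QU L c c' n i h then (if i = n/2 then y ^ h else 1) else 0)
        c n c' := by
  obtain ⟨ℓ, k, hℓ, hkℓ, hℓk, hblock⟩ := exists_block y θ hy hθ hB
  set C : ℝ := (ℓ.choose k : ℝ) with hC
  set K := L + ℓ + 2 with hK
  set b := min 1 y with hb
  have hb0 : 0 < b := lt_min one_pos hy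
  have hb1 : b ≤ 1 := min_le_left _ _
  have hmx : (1:ℝ) ≤ max 1 θ := le_max_left _ _
  refine ⟨b ^ (K + ℓ + 2) / (max 1 θ) ^ (2 * (K + ℓ) + 1), 2 * (K + ℓ) + 2, by positivity, ?_⟩
  intro n hn c c' hc hc' hpar
  set J := (n/2 - K) / ℓ with hJ
  have hdm := Nat.div_add_mod (n/2-K) ℓ
  have hml := Nat.mod_lt (n/2-K) hℓ
  rw [← hJ, mul_comm] at hdm
  have hJ1 : 1 ≤ J := by
    rw [hJ, Nat.le_div_iff_mul_le hℓ]; omega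
  have hJl : ℓ ≤ J * ℓ := Nat.le_mul_of_pos_left _ (by omega)
  obtain ⟨p, hp⟩ : ∃ p, p = n/2 - J*ℓ := ⟨_, rfl⟩
  have hp1 : K ≤ p := by omega
  have hp2 : p < K + ℓ := by omega
  have hp3 : p + J * ℓ = n/2 := by omega
  have hp4 : p < n/2 := by omega
  set V : ℕ → ℤ → ℝ :=
    fun i h => if QU L c c' n i h then (if i = n/2 then y ^ h else 1) else 0 with hV
  have hVn : ∀ i h, 0 ≤ V i h := by
    intro i h; simp only [hV]; split_ifs <;> positivity
  set f := mu V c with hf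
  have hf0 : ∀ i h, 0 ≤ f i h := mu_nonneg V c hVn
  have hstep : ∀ i h, i + 1 ≠ n/2 → QU L c c' n (i+1) h → f (i+1) h = f i (h-1) + f i (h+1) := by
    intro i h hi hq
    simp only [hf, mu, hV]
    rw [if_pos hq, if_neg hi, one_mul]
  have hstepm : ∀ i h, i + 1 = n/2 → QU L c c' n (i+1) h →
      f (i+1) h = y ^ h * (f i (h-1) + f i (h+1)) := by
    intro i h hi hq
    simp only [hf, mu, hV]
    rw [if_pos hq, if_pos hi]
  have qL : ∀ i (h : ℤ), (L:ℤ) + 1 ≤ h → QU L c c' n i h :=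
    fun i h hh => (min_le_left _ _).trans hh
  -- initial ascent
  have start : ∀ i, i ≤ p → 1 ≤ f i ((c:ℤ) + i) := by
    intro i
    induction i with
    | zero =>
      intro _
      simp only [hf, mu, hV]
      rw [if_pos (by simp), if_pos, if_neg (by omega)]
      unfold QU; omega
    | succ i ih =>
      intro hi
      have h1 := ih (by omega)
      rw [hstep i _ (by omega) (by unfold QU; push_cast; omega)]
      have h2 := hf0 i ((c:ℤ) + ((i+1:ℕ):ℤ) + 1)
      rw [show (c:ℤ) + ((i+1:ℕ):ℤ) - 1 = c + i by push_cast; ring]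
      linarith
  -- first half
  obtain ⟨D, hD⟩ : ∃ D : ℤ, D = 2 * (k:ℤ) - ℓ := ⟨_, rfl⟩
  have hD0 : 0 ≤ D := by omega
  have hJD : ∀ j : ℕ, 0 ≤ (j:ℤ) * D := fun j => mul_nonneg (by omega) hD0
  let g : ℕ → ℤ → ℝ := fun i h => if i = n/2 then f i h / y ^ h else f i h
  have hg0 : ∀ i h, 0 ≤ g i h := by
    intro i h
    simp only [g]
    have := hf0 i h
    split_ifs <;> positivity
  have half1 : C ^ J ≤ g (n/2) ((c:ℤ) + p + J * D) := by
    have := blocks (fun i => g (p + i)) (fun i h => hg0 _ h) ℓ k (L+1) ((c:ℤ)+p) J ?_ ?_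
    · simp only [add_zero] at this
      rw [hp3, ← hC, ← hD] at this
      refine le_trans ?_ this
      have h1 := start p le_rfl
      have h2 : g p ((c:ℤ)+p) = f p ((c:ℤ)+p) := by simp only [g]; rw [if_neg (by omega)]
      rw [h2]
      have : 0 ≤ C ^ J := by positivity
      nlinarith
    · intro i hi h hh
      simp only [g]
      rw [if_neg (by omega), if_neg (by omega)]
      by_cases e : p + (i+1) = n/2
      · rw [if_pos e, ← add_assoc, hstepm (p+i) h (by omega) (qL _ _ hh)]
        have : 0 < y ^ h := by positivity
        rw [mul_div_cancel_left₀ _ this.ne']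
      · rw [if_neg e, ← add_assoc, hstep (p+i) h (by omega) (qL _ _ hh)]
    · intro j hj
      rw [← hD]
      have := hJD j
      omega
  obtain ⟨h0, hh0⟩ : ∃ h0 : ℤ, h0 = (c:ℤ) + p + J * D := ⟨_, rfl⟩
  rw [← hh0] at half1
  have hmid : y ^ h0 * C ^ J ≤ f (n/2) h0 := by
    simp only [g, if_true] at half1
    rw [le_div_iff₀ (by positivity)] at half1
    linarith
  have half2 : C ^ J * f (n/2) h0 ≤ f (n/2 + J*ℓ) ((c:ℤ)+p) := by
    have := blocks (fun i => f (n/2 + i)) (fun i h => hf0 _ h) ℓ (ℓ-k) (L+1) h0 J ?_ ?_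
    · simp only [add_zero] at this
      rw [Nat.choose_symm hkℓ, ← hC] at this
      rw [show h0 + (J:ℤ) * (2 * ((ℓ-k:ℕ):ℤ) - ℓ) = (c:ℤ) + p by
        rw [hh0, hD, Nat.cast_sub hkℓ]; ring] at this
      exact this
    · intro i hi h hh
      exact (hstep (n/2+i) h (by omega) (qL _ _ hh)).ge
    · intro j hj
      have e : 2 * ((ℓ-k:ℕ):ℤ) - ℓ = -D := by rw [Nat.cast_sub hkℓ, hD]; ring
      have e2 : (j:ℤ) * D ≤ J * D := mul_le_mul_of_nonneg_right (by omega) hD0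
      rw [e, mul_neg]
      omega
  set W := y ^ h0 * (C ^ J * C ^ J) with hW
  have hW1 : W ≤ f (n/2 + J*ℓ) ((c:ℤ)+p) := by
    refine le_trans ?_ half2
    calc W = C ^ J * (y ^ h0 * C ^ J) := by rw [hW]; ring
      _ ≤ _ := mul_le_mul_of_nonneg_left hmid (by positivity)
  -- final descent
  obtain ⟨t, ht1, ht2, ht⟩ : ∃ t, n/2 ≤ t ∧ t ≤ n ∧ W ≤ f t ((c':ℤ) + n - t) := by
    by_cases e : c' = c + 1
    · refine ⟨n/2 + J*ℓ + 1, by omega, by omega, ?_⟩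
      rw [hstep _ _ (by omega) (qL _ _ (by push_cast; omega))]
      have h2 := hf0 (n/2 + J*ℓ) ((c':ℤ) + n - ((n/2 + J*ℓ + 1 : ℕ):ℤ) + 1)
      rw [show (c':ℤ) + n - ((n/2 + J*ℓ + 1 : ℕ):ℤ) - 1 = (c:ℤ) + p by omega]
      linarith
    · refine ⟨n/2 + J*ℓ, by omega, by omega, ?_⟩
      rw [show (c':ℤ) + n - ((n/2 + J*ℓ : ℕ):ℤ) = (c:ℤ) + p by omega]
      exact hW1
  have desc : ∀ i, t + i ≤ n → W ≤ f (t+i) ((c':ℤ) + n - ((t+i:ℕ):ℤ)) := by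
    intro i
    induction i with
    | zero => intro _; exact ht
    | succ i ih =>
      intro hi
      have h1 := ih (by omega)
      rw [← add_assoc, hstep (t+i) _ (by omega) (by unfold QU; push_cast; omega)]
      have h2 := hf0 (t+i) ((c':ℤ) + n - ((t+i+1:ℕ):ℤ) - 1)
      rw [show (c':ℤ) + n - ((t+i+1:ℕ):ℤ) + 1 = (c':ℤ) + n - ((t+i:ℕ):ℤ) by push_cast; ring]
      linarith
  have fin := desc (n - t) (by omega)
  rw [show t + (n-t) = n by omega, show (c':ℤ) + n - n = c' by ring] at fin
  refine le_trans ?_ fin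
  have hyb : b ^ (K + ℓ + 2) ≤ y ^ (c + p) := by
    calc b ^ (K + ℓ + 2) ≤ b ^ (c+p) := pow_le_pow_of_le_one hb0.le hb1 (by omega)
      _ ≤ y ^ (c+p) := pow_le_pow_left₀ hb0.le (min_le_right _ _) _
  have hps := pow_shift θ hθ n (2*(J*ℓ)) (n - 2*(J*ℓ)) (2*(K+ℓ)+1) (by omega) (by omega)
  have hWe : W = y ^ (c+p) * (C^2 * y ^ D) ^ J := by
    rw [hW, hh0, zpow_add₀ hy.ne', mul_pow, mul_comm (J:ℤ) D, zpow_mul, zpow_natCast,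
      show (c:ℤ) + p = ((c+p:ℕ):ℤ) by push_cast; ring, zpow_natCast]
    ring
  rw [← hD] at hblock
  calc _ = b ^ (K + ℓ + 2) * (θ ^ n / (max 1 θ) ^ (2 * (K + ℓ) + 1)) := by ring
    _ ≤ y ^ (c+p) * θ ^ (2*(J*ℓ)) := mul_le_mul hyb hps (by positivity) (by positivity)
    _ = y ^ (c+p) * (θ ^ (2*ℓ)) ^ J := by rw [← pow_mul]; congr 2; ring
    _ ≤ y ^ (c+p) * (C^2 * y ^ D) ^ J := by gcongr
    _ = W := hWe.symm

/-! ### Assembly -/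

/-- left endpoint height -/
def c0 (n : ℕ) : ℕ := if n % 4 < 2 then 2 else 1
/-- right endpoint height -/
def c1 (n : ℕ) : ℕ := if n % 4 = 0 ∨ n % 4 = 3 then 2 else 1

theorem PGC_eq (n : ℕ) (hn : 2 ≤ n) (a y : ℝ) :
    PGC n a y = ∑ sp : Fin n → Bool, ∑ sm : Fin n → Bool,
      if (IsStaircase (c0 n : ℤ) sp sm ∧ hgt (c0 n : ℤ) sm (n/2) = 0 ∧
        hgt (c0 n : ℤ) sp n = (c1 n : ℤ)) then
        a ^ visits (c0 n : ℤ) sm * y ^ hgt (c0 n : ℤ) sp (n/2) else 0 := by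
  have hc : c0 n < n + 1 := by unfold c0; split_ifs <;> omega
  unfold PGC
  rw [Finset.sum_filter, Fintype.sum_prod_type, Finset.sum_eq_single (⟨c0 n, hc⟩ : Fin (n+1))]
  · rw [Fintype.sum_prod_type]
    apply Finset.sum_congr rfl
    intro sp _
    apply Finset.sum_congr rfl
    intro sm _
    dsimp only
    congr 1
    apply propext
    apply and_congr_right
    intro _
    apply and_congr_right
    intro _
    generalize hgt (c0 n : ℤ) sp n = z
    unfold c0 c1
    have : n % 4 < 4 := Nat.mod_lt _ (by norm_num)
    constructor
    · rintro ⟨h1, h2, h3, h4⟩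
      split_ifs at h1 h2 h3 h4 ⊢ <;> (push_cast; omega)
    · intro h
      refine ⟨fun e => ?_, fun e => ?_, fun e => ?_, fun e => ?_⟩ <;>
        simp [e] at h ⊢ <;> omega
  · intro b _ hb
    apply Finset.sum_eq_zero
    intro p _
    rw [if_neg]
    rintro ⟨_, _, h1, h2, h3, h4⟩
    apply hb
    ext
    dsimp only at h1 h2 h3 h4 ⊢
    unfold c0
    split_ifs <;> omega
  · intro h; exact absurd (Finset.mem_univ _) h

theorem PGC_lower (n : ℕ) (hn : 4 ≤ n) (a y : ℝ) (ha : 0 < a) (hy : 0 < y) (L : ℕ) :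
    mu (fun i h => if QU L (c0 n) (c1 n) n i h then (if i = n/2 then y ^ h else 1) else 0)
        (c0 n) n (c1 n) *
      mu (fun i h => if QL L (c0 n) (c1 n) n i h then wt a h else 0) (c0 n) n (c1 n)
      ≤ PGC n a y := by
  have hc : c0 n = 1 ∨ c0 n = 2 := by unfold c0; split_ifs <;> simp
  have hc' : c1 n = 1 ∨ c1 n = 2 := by unfold c1; split_ifs <;> simp
  rw [PGC_eq n (by omega), ← pathsum_cond (QU L (c0 n) (c1 n) n)
    (fun i h => if i = n/2 then y ^ h else 1),
    ← pathsum_cond (QL L (c0 n) (c1 n) n) (fun _ h => wt a h), Finset.sum_mul_sum]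
  generalize c0 n = c at *
  generalize c1 n = c' at *
  apply Finset.sum_le_sum
  intro sp _
  apply Finset.sum_le_sum
  intro sm _
  rw [prod_wt, prod_mid]
  by_cases hP : hgt (c:ℤ) sp n = (c':ℤ) ∧ ∀ i ≤ n, QU L c c' n i (hgt c sp i)
  swap
  · rw [if_neg hP, zero_mul]; split_ifs <;> positivity
  by_cases hQ : hgt (c:ℤ) sm n = (c':ℤ) ∧ ∀ i ≤ n, QL L c c' n i (hgt c sm i)
  swap
  · rw [if_neg hQ, mul_zero]; split_ifs <;> positivity
  rw [if_pos hP, if_pos hQ, if_pos, mul_comm]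
  obtain ⟨hP1, hP2⟩ := hP
  obtain ⟨hQ1, hQ2⟩ := hQ
  have hmid : hgt (c:ℤ) sm (n/2) = 0 := (hQ2 (n/2) (by omega)).2.2.2.2 rfl
  refine ⟨⟨by rw [hP1, hQ1], ?_, ?_, ?_, ⟨n/2, by omega, Or.inr hmid⟩⟩, hmid, hP1⟩
  · intro i hi hin
    have q1 := (hQ2 1 (by omega)).2.2.1 rfl
    have q2 := (hQ2 (n-1) (by omega)).2.2.2.1 (by omega)
    have q3 := (hQ2 i (by omega)).2.1
    have u := hP2 i (by omega)
    have l1 := (hgt_lip (c:ℤ) sm 1 (i-1)).1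
    have l2 := (hgt_lip (c:ℤ) sm i (n-1-i)).2
    rw [show 1 + (i-1) = i by omega] at l1
    rw [show i + (n-1-i) = n-1 by omega] at l2
    unfold QU at u
    omega
  · intro i hi
    have u := hP2 i hi
    unfold QU at u
    omega
  · intro i hi
    exact (hQ2 i hi).1

theorem PGC_upper (n : ℕ) (hn : 4 ≤ n) (a y : ℝ) (ha : 0 < a) (hy : 0 < y) :
    PGC n a y ≤
    mu (fun i h => if 0 ≤ h then (if i = n/2 then y ^ h else 1) else 0) (c0 n) n (c1 n) *
      mu (fun _ h => if 0 ≤ h then wt a h else 0) (c0 n) n (c1 n) := by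
  have q1 := pathsum_cond (fun _ h => 0 ≤ h) (fun i h => if i = n/2 then y ^ h else 1)
    (c0 n) n (c1 n)
  have q2 := pathsum_cond (fun _ h => 0 ≤ h) (fun _ h => wt a h) (c0 n) n (c1 n)
  have r1 : mu (fun i h => if 0 ≤ h then (if i = n/2 then y ^ h else 1) else 0) (c0 n) n (c1 n)
      = _ := Eq.trans (by congr!) q1.symm
  have r2 : mu (fun _ h => if 0 ≤ h then wt a h else 0) (c0 n) n (c1 n)
      = _ := Eq.trans (by congr!) q2.symm
  rw [PGC_eq n (by omega), r1, r2, Finset.sum_mul_sum]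
  clear q1 q2 r1 r2
  generalize c0 n = c at *
  generalize c1 n = c' at *
  apply Finset.sum_le_sum
  intro sp _
  apply Finset.sum_le_sum
  intro sm _
  rw [prod_wt, prod_mid]
  by_cases hR : (IsStaircase (c : ℤ) sp sm ∧ hgt (c : ℤ) sm (n/2) = 0 ∧
        hgt (c : ℤ) sp n = (c' : ℤ))
  · obtain ⟨⟨h1, h2, h3, h4, h5⟩, h6, h7⟩ := hR
    rw [if_pos ⟨⟨h1, h2, h3, h4, h5⟩, h6, h7⟩, if_pos ⟨h7, h3⟩, if_pos ⟨h1 ▸ h7, h4⟩, mul_comm]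
  · rw [if_neg hR]
    split_ifs <;> positivity

theorem PGC_ge (a y : ℝ) (ha : 0 < a) (hy : 0 < y) (θ₁ θ₂ : ℝ) (h1 : 0 < θ₁) (h2 : 0 < θ₂)
    (hA : θ₁ < grA a) (hB : θ₂ < grB y) :
    ∃ κ : ℝ, 0 < κ ∧ ∀ᶠ n : ℕ in atTop, κ * (θ₁ * θ₂) ^ n ≤ PGC n a y := by
  obtain ⟨L, κ₁, N₁, hL, hκ₁, hlow⟩ := low_lower a θ₁ ha h1 hA
  obtain ⟨κ₂, N₂, hκ₂, hup⟩ := up_lower y θ₂ hy h2 hB L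
  refine ⟨κ₂ * κ₁, by positivity, ?_⟩
  filter_upwards [eventually_ge_atTop (N₁ + N₂ + 8)] with n hn
  have hc : c0 n = 1 ∨ c0 n = 2 := by unfold c0; split_ifs <;> simp
  have hc' : c1 n = 1 ∨ c1 n = 2 := by unfold c1; split_ifs <;> simp
  have p1 : (n/2 - c0 n) % 2 = 0 := by unfold c0; split_ifs <;> omega
  have p2 : (n - n/2 - c1 n) % 2 = 0 := by unfold c1; split_ifs <;> omega
  have p3 : (n + c0 n + c1 n) % 2 = 0 := by omega
  have e1 := hlow n (by omega) _ _ hc hc' p1 p2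
  have e2 := hup n (by omega) _ _ hc hc' p3
  refine le_trans ?_ (PGC_lower n (by omega) a y ha hy L)
  calc _ = (κ₂ * θ₂ ^ n) * (κ₁ * θ₁ ^ n) := by rw [mul_pow]; ring
    _ ≤ _ := mul_le_mul e2 e1 (by positivity) (le_trans (by positivity) e2)

theorem PGC_le (a y : ℝ) (ha : 0 < a) (hy : 0 < y) :
    ∃ κ : ℝ, 0 < κ ∧ ∀ᶠ n : ℕ in atTop, PGC n a y ≤ κ * (grA a * grB y) ^ n := by
  have hl := lamb_pos a
  have hl1 := lamb_le_one a
  have ht := tilt_pos y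
  have ht1 := tilt_ge_one y
  have hA := grA_pos a
  have hB := grB_pos y
  refine ⟨tilt y ^ 4 * (lamb a) ^ (-2:ℤ), by positivity, ?_⟩
  filter_upwards [eventually_ge_atTop 4] with n hn
  have hc : c0 n = 1 ∨ c0 n = 2 := by unfold c0; split_ifs <;> simp
  have hc' : c1 n = 1 ∨ c1 n = 2 := by unfold c1; split_ifs <;> simp
  refine (PGC_upper n hn a y ha hy).trans ?_
  have e1 := low_upper a ha (c0 n) (by omega) n (c1 n)
  have e2 := up_upper y hy (c0 n) (n/2) n (c1 n)
  rw [if_neg (by omega)] at e2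
  rw [if_pos (by omega)] at e1
  have e1' : mu (fun _ h => if 0 ≤ h then wt a h else 0) (c0 n) n (c1 n)
      ≤ lamb a ^ (-2:ℤ) * grA a ^ n := by
    refine e1.trans ?_
    have g1 : lamb a ^ (-(c0 n : ℤ)) ≤ lamb a ^ (-2:ℤ) :=
      zpow_le_zpow_right_of_le_one₀ hl hl1 (by omega)
    have g2 : lamb a ^ (c1 n : ℤ) ≤ 1 := by
      rw [zpow_natCast]; exact pow_le_one₀ hl.le hl1
    calc _ ≤ lamb a ^ (-2:ℤ) * grA a ^ n * 1 := by gcongr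
      _ = _ := mul_one _
  have e2' : mu (fun i h => if 0 ≤ h then (if i = n/2 then y ^ h else 1) else 0) (c0 n) n (c1 n)
      ≤ grB y ^ n * tilt y ^ 4 := by
    refine e2.trans ?_
    have g1 : tilt y ^ ((c0 n : ℤ) + c1 n) ≤ tilt y ^ (4:ℤ) :=
      zpow_le_zpow_right₀ ht1 (by omega)
    have : tilt y ^ (4:ℤ) = tilt y ^ 4 := by
      rw [show (4:ℤ) = ((4:ℕ):ℤ) from rfl, zpow_natCast]
    rw [this] at g1
    gcongr
  calc _ ≤ (grB y ^ n * tilt y ^ 4) * (lamb a ^ (-2:ℤ) * grA a ^ n) := by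
        apply mul_le_mul e2' e1' _ (by positivity)
        apply mu_nonneg
        intro i h
        split_ifs
        · exact (wt_pos ha h).le
        · exact le_rfl
    _ = _ := by rw [mul_pow]; ring

theorem PGC_le_PC (n : ℕ) (a y : ℝ) (ha : 0 < a) (hy : 0 < y) : PGC n a y ≤ PC n a y := by
  unfold PGC PC
  apply Finset.sum_le_sum_of_subset_of_nonneg
  · intro p hp
    rw [Finset.mem_filter] at hp ⊢
    exact ⟨hp.1, hp.2.1, hp.2.2.1⟩
  · intro p _ _
    positivity

theorem PC_le (n : ℕ) (a y : ℝ) (ha : 0 < a) (hy : 0 < y) (hn : 1 ≤ n) :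
    PC n a y ≤ (8 * (max 1 a)^2 * (max 1 y)^2) ^ n := by
  have ha1 : 1 ≤ max 1 a := le_max_left _ _
  have hy1 : 1 ≤ max 1 y := le_max_left _ _
  have hb : PC n a y ≤ ∑ p : Fin (n + 1) × (Fin n → Bool) × (Fin n → Bool),
      (max 1 a)^(2*n) * (max 1 y)^(2*n) := by
    unfold PC
    rw [Finset.sum_filter]
    apply Finset.sum_le_sum
    intro p _
    split_ifs with hp
    · apply mul_le_mul _ _ (by positivity) (by positivity)
      · have hv : visits ((p.1:ℕ):ℤ) p.2.2 ≤ n + 1 := by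
          unfold visits
          exact (Finset.card_filter_le _ _).trans (by simp)
        exact (pow_le_pow_left₀ ha.le (le_max_right 1 a) _).trans
          (pow_le_pow_right₀ ha1 (by omega))
      · have h0 := hp.1.2.2.1 (n/2) (by omega)
        have h1 := (hgt_lip ((p.1:ℕ):ℤ) p.2.1 0 (n/2)).1
        rw [hgt_zero, zero_add] at h1
        have h2 := p.1.isLt
        obtain ⟨z, hz⟩ := Int.eq_ofNat_of_zero_le h0
        rw [hz, zpow_natCast]
        rw [hz] at h1
        exact (pow_le_pow_left₀ hy.le (le_max_right 1 y) _).trans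
          (pow_le_pow_right₀ hy1 (by omega))
    · positivity
  refine hb.trans ?_
  rw [Finset.sum_const, nsmul_eq_mul]
  simp only [Finset.card_univ, Fintype.card_prod, Fintype.card_fin, Fintype.card_fun,
    Fintype.card_bool]
  have h2 : ((n + 1 : ℕ):ℝ) ≤ 2 ^ n := by exact_mod_cast Nat.lt_two_pow_self
  push_cast at h2 ⊢
  calc ((n:ℝ)+1) * (2^n * 2^n) * ((max 1 a)^(2*n) * (max 1 y)^(2*n))
      ≤ 2 ^ n * (2^n * 2^n) * ((max 1 a)^(2*n) * (max 1 y)^(2*n)) := by gcongr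
    _ = _ := by
      rw [pow_mul, pow_mul, mul_pow, mul_pow, show (8:ℝ) = 2*2*2 by norm_num, mul_pow, mul_pow]
      ring

/-- The free energy of grafted-and-centred staircase polygons exists, equals `ψ^G(a,y)`,
and `ψ^G(a,y)` is a lower bound for the `liminf` for centred polygons. -/
theorem psiGC_exists_and_lb (a y : ℝ) (ha : 0 < a) (hy : 0 < y) :
    Tendsto (fun n : ℕ => Real.log (PGC n a y) / (2 * n)) atTop (nhds (psiGval a y)) ∧
    psiGval a y ≤ Filter.liminf (fun n : ℕ => Real.log (PC n a y) / (2 * n)) atTop := by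
  have hA := grA_pos a
  have hB := grB_pos y
  -- lower bound
  have low : ∀ t < psiGval a y, ∀ᶠ n : ℕ in atTop,
      0 < PGC n a y ∧ t < Real.log (PGC n a y) / (2 * n) := by
    intro t ht
    rw [psiGval_eq] at ht
    obtain ⟨ε, hε⟩ : ∃ ε, ε = ((Real.log (grA a) + Real.log (grB y)) - 2 * t) / 4 := ⟨_, rfl⟩
    have hε0 : 0 < ε := by rw [hε]; linarith
    have hlt : Real.exp (-ε) < 1 := by rw [Real.exp_lt_one_iff]; linarith
    have hep := Real.exp_pos (-ε)
    obtain ⟨κ, hκ, hev⟩ := PGC_ge a y ha hy (grA a * Real.exp (-ε)) (grB y * Real.exp (-ε))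
      (by positivity) (by positivity) (by nlinarith) (by nlinarith)
    have hlim : Tendsto (fun n : ℕ => Real.log κ / (n:ℝ)) atTop (nhds 0) :=
      tendsto_const_div_atTop_nhds_zero_nat _
    have hev2 := hlim.eventually (lt_mem_nhds (by linarith : -(2 * ε) < 0))
    filter_upwards [hev, hev2, eventually_ge_atTop 1] with n h1 h2 h3
    have hn : (0:ℝ) < n := by exact_mod_cast h3
    have hpos : 0 < κ * (grA a * Real.exp (-ε) * (grB y * Real.exp (-ε))) ^ n := by positivity
    refine ⟨lt_of_lt_of_le hpos h1, ?_⟩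
    have h4 := Real.log_le_log hpos h1
    rw [Real.log_mul (by positivity) (by positivity), Real.log_pow,
      Real.log_mul (by positivity) (by positivity), Real.log_mul (by positivity) (by positivity),
      Real.log_mul (by positivity) (by positivity), Real.log_exp] at h4
    rw [lt_div_iff₀ hn] at h2
    rw [lt_div_iff₀ (by positivity)]
    have h5 : (n:ℝ) * (Real.log (grA a) + -ε + (Real.log (grB y) + -ε)) = n * (2 * t + 2 * ε) := by
      rw [hε]; ring
    rw [h5] at h4
    nlinarith
  have upp : ∀ t > psiGval a y, ∀ᶠ n : ℕ in atTop, Real.log (PGC n a y) / (2 * n) < t := by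
    intro t ht
    have hl := low (psiGval a y - 1) (by linarith)
    rw [psiGval_eq] at ht
    obtain ⟨ε, hε⟩ : ∃ ε, ε = 2 * t - (Real.log (grA a) + Real.log (grB y)) := ⟨_, rfl⟩
    have hε0 : 0 < ε := by rw [hε]; linarith
    obtain ⟨κ, hκ, hev⟩ := PGC_le a y ha hy
    have hlim : Tendsto (fun n : ℕ => Real.log κ / (n:ℝ)) atTop (nhds 0) :=
      tendsto_const_div_atTop_nhds_zero_nat _
    have hev2 := hlim.eventually (gt_mem_nhds hε0)
    filter_upwards [hev, hev2, hl, eventually_ge_atTop 1] with n h1 h2 h0 h3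
    have hn : (0:ℝ) < n := by exact_mod_cast h3
    have h4 := Real.log_le_log h0.1 h1
    rw [Real.log_mul (by positivity) (by positivity), Real.log_pow,
      Real.log_mul (by positivity) (by positivity)] at h4
    rw [div_lt_iff₀ hn] at h2
    rw [div_lt_iff₀ (by positivity)]
    have h5 : (n:ℝ) * (Real.log (grA a) + Real.log (grB y)) = n * (2 * t - ε) := by
      rw [hε]; ring
    rw [h5] at h4
    nlinarith
  refine ⟨tendsto_order.2 ⟨fun t ht => (low t ht).mono fun n h => h.2, upp⟩, ?_⟩
  apply le_of_forall_lt
  intro t ht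
  obtain ⟨t', ht1, ht2⟩ := exists_between ht
  refine lt_of_lt_of_le ht1 ?_
  have hbd : IsBoundedUnder (· ≤ ·) atTop (fun n : ℕ => Real.log (PC n a y) / (2 * n)) := by
    refine ⟨Real.log (8 * (max 1 a)^2 * (max 1 y)^2) / 2, ?_⟩
    rw [eventually_map]
    filter_upwards [low t' ht2, eventually_ge_atTop 1] with n h1 h3
    have hn : (0:ℝ) < n := by exact_mod_cast h3
    have hpos : 0 < PC n a y := lt_of_lt_of_le h1.1 (PGC_le_PC n a y ha hy)
    have h4 := Real.log_le_log hpos (PC_le n a y ha hy h3)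
    rw [Real.log_pow] at h4
    rw [div_le_iff₀ (by positivity)]
    linarith
  apply le_liminf_of_le hbd.isCoboundedUnder_ge
  filter_upwards [low t' ht2, eventually_ge_atTop 1] with n h1 h3
  have hn : (0:ℝ) < n := by exact_mod_cast h3
  refine h1.2.le.trans ?_
  exact div_le_div_of_nonneg_right (Real.log_le_log h1.1 (PGC_le_PC n a y ha hy)) (by positivity)
end

section
/- For every a > 0 and every y > 1, liminf_{n→∞} (1/(2n)) log P^C_{2n}(a,y) ≥ log(y+1) − (1/2) log y. -/
open Finset Filter

attribute [local instance] Classical.propDecidable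

namespace PCaux

theorem hgt_zero {n : ℕ} (c : ℤ) (s : Fin n → Bool) : hgt c s 0 = c := by simp [hgt]

theorem hgt_succ {n : ℕ} (c : ℤ) (s : Fin n → Bool) (i : ℕ) (h : i < n) :
    hgt c s (i + 1) = hgt c s i + (if s ⟨i, h⟩ then (1 : ℤ) else -1) := by
  simp [hgt, Finset.sum_range_succ, h, add_assoc]

theorem hgt_abs {n : ℕ} (c : ℤ) (s : Fin n → Bool) (i : ℕ) (h : i ≤ n) :
    hgt c s i ≤ c + i ∧ c - i ≤ hgt c s i := by
  induction i with
  | zero => simp [hgt_zero]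
  | succ i ih =>
    have := ih (by omega)
    rw [hgt_succ c s i (by omega)]
    push_cast
    split_ifs <;> omega

/-- Words of length `m` and total displacement `w` whose intermediate heights lie in `(0,w)`. -/
noncomputable def good (m : ℕ) (w : ℤ) : Finset (Fin m → Bool) :=
  Finset.univ.filter (fun s => hgt 0 s m = w ∧ (∀ i, 0 < i → i ≤ m → 0 < hgt 0 s i) ∧
    (∀ i < m, hgt 0 s i < w))

/-- the lower path -/
def mkM (m n : ℕ) (V W : Fin m → Bool) : Fin n → Bool := fun j =>
  if h : (j : ℕ) < m then !(V ⟨j, h⟩) else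
    if h : m ≤ n - 1 - j then true else
      W ⟨m - (n - j), by have := j.2; omega⟩

/-- the upper path -/
def mkP (m n : ℕ) (V W : Fin m → Bool) : Fin n → Bool := fun j =>
  if h : (j : ℕ) < m then V ⟨j, h⟩ else
    if h : m ≤ n - 1 - j then true else
      !(W ⟨m - (n - j), by have := j.2; omega⟩)

theorem hgt_mkM_left (m n : ℕ) (hn : 2 * m ≤ n) (V W : Fin m → Bool) (w : ℤ) (i : ℕ) (hi : i ≤ m) :
    hgt w (mkM m n V W) i = w - hgt 0 V i := by
  induction i with
  | zero => simp [hgt_zero]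
  | succ i ih =>
    rw [hgt_succ _ _ _ (by omega), hgt_succ _ _ _ (by omega), ih (by omega)]
    have : i < m := by omega
    simp only [mkM, this, dite_true]
    cases V ⟨i, this⟩ <;> simp <;> omega

theorem hgt_mkP_left (m n : ℕ) (hn : 2 * m ≤ n) (V W : Fin m → Bool) (w : ℤ) (i : ℕ) (hi : i ≤ m) :
    hgt w (mkP m n V W) i = w + hgt 0 V i := by
  induction i with
  | zero => simp [hgt_zero]
  | succ i ih =>
    rw [hgt_succ _ _ _ (by omega), hgt_succ _ _ _ (by omega), ih (by omega)]
    have : i < m := by omega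
    simp only [mkP, this, dite_true]
    omega

theorem hgt_mkM_mid (m n : ℕ) (e : ℕ) (hn : n = 2 * m + e) (V W : Fin m → Bool)
    (w : ℤ) (hV : hgt 0 V m = w) (i : ℕ) (hi : i ≤ e) :
    hgt w (mkM m n V W) (m + i) = i := by
  induction i with
  | zero => simp [hgt_mkM_left m n (by omega), hV]
  | succ i ih =>
    rw [← add_assoc, hgt_succ _ _ _ (by omega), ih (by omega)]
    have : ¬ (m + i < m) := by omega
    have h2 : m ≤ n - 1 - (m + i) := by omega
    simp [mkM, h2]

theorem hgt_mkP_mid (m n : ℕ) (e : ℕ) (hn : n = 2 * m + e) (V W : Fin m → Bool)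
    (w : ℤ) (hV : hgt 0 V m = w) (i : ℕ) (hi : i ≤ e) :
    hgt w (mkP m n V W) (m + i) = 2 * w + i := by
  induction i with
  | zero => simp [hgt_mkP_left m n (by omega), hV]; omega
  | succ i ih =>
    rw [← add_assoc, hgt_succ _ _ _ (by omega), ih (by omega)]
    have : ¬ (m + i < m) := by omega
    have h2 : m ≤ n - 1 - (m + i) := by omega
    simp [mkP, h2]; ring

theorem hgt_mkM_right (m n : ℕ) (e : ℕ) (hn : n = 2 * m + e) (V W : Fin m → Bool)
    (w : ℤ) (hV : hgt 0 V m = w) (i : ℕ) (hi : i ≤ m) :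
    hgt w (mkM m n V W) (m + e + i) = e + hgt 0 W i := by
  induction i with
  | zero => simp [hgt_mkM_mid m n e hn V W w hV, hgt_zero]
  | succ i ih =>
    rw [← add_assoc, hgt_succ _ _ _ (by omega), hgt_succ _ _ _ (by omega), ih (by omega)]
    have h1 : ¬ (m + e + i < m) := by omega
    have h2 : ¬ (m ≤ n - 1 - (m + e + i)) := by omega
    have h3 : m - (n - (m + e + i)) = i := by omega
    simp [mkM, h1, h2, h3]; omega

theorem hgt_mkP_right (m n : ℕ) (e : ℕ) (hn : n = 2 * m + e) (V W : Fin m → Bool)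
    (w : ℤ) (hV : hgt 0 V m = w) (i : ℕ) (hi : i ≤ m) :
    hgt w (mkP m n V W) (m + e + i) = 2 * w + e - hgt 0 W i := by
  induction i with
  | zero => simp [hgt_mkP_mid m n e hn V W w hV, hgt_zero]
  | succ i ih =>
    rw [← add_assoc, hgt_succ _ _ _ (by omega), hgt_succ _ _ _ (by omega), ih (by omega)]
    have h1 : ¬ (m + e + i < m) := by omega
    have h2 : ¬ (m ≤ n - 1 - (m + e + i)) := by omega
    have h3 : m - (n - (m + e + i)) = i := by omega
    simp only [mkP, h1, h2, h3, dite_false]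
    cases W ⟨i, by omega⟩ <;> simp <;> omega

theorem mkM_inj (m n : ℕ) (hn : 2 * m ≤ n) (V W V' W' : Fin m → Bool)
    (h : mkM m n V W = mkM m n V' W') : V = V' ∧ W = W' := by
  constructor
  · funext j
    have := congrFun h ⟨j, by omega⟩
    simpa [mkM] using this
  · funext j
    have := congrFun h ⟨n - m + j, by omega⟩
    have h1 : ¬ (n - m + j < m) := by omega
    have h2 : ¬ (m ≤ n - 1 - (n - m + j)) := by omega
    have h3 : m - (n - (n - m + j)) = j := by omega
    simpa [mkM, h1, h2, h3] using this

theorem mkP_inj (m n : ℕ) (hn : 2 * m ≤ n) (V W V' W' : Fin m → Bool)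
    (h : mkP m n V W = mkP m n V' W') : V = V' ∧ W = W' := by
  constructor
  · funext j
    have := congrFun h ⟨j, by omega⟩
    simpa [mkP] using this
  · funext j
    have := congrFun h ⟨n - m + j, by omega⟩
    have h1 : ¬ (n - m + j < m) := by omega
    have h2 : ¬ (m ≤ n - 1 - (n - m + j)) := by omega
    have h3 : m - (n - (n - m + j)) = j := by omega
    simpa [mkP, h1, h2, h3] using this

theorem good_spec (m n e : ℕ) (hn : n = 2 * m + e) (w : ℕ) (hm : 0 < m)
    (V W V' W' : Fin m → Bool)
    (hV : V ∈ good m w) (hW : W ∈ good m w) (hV' : V' ∈ good m w) (hW' : W' ∈ good m w) :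
    IsStaircase (w : ℤ) (mkP m n V' W') (mkM m n V W) ∧
      hgt (w : ℤ) (mkM m n V W) m = 0 ∧ hgt (w : ℤ) (mkP m n V' W') m = 2 * w ∧
      visits (w : ℤ) (mkM m n V W) = 1 := by
  simp only [good, mem_filter, mem_univ, true_and] at hV hW hV' hW'
  obtain ⟨v1, v2, v3⟩ := hV
  obtain ⟨w1, w2, w3⟩ := hW
  obtain ⟨v1', v2', v3'⟩ := hV'
  obtain ⟨w1', w2', w3'⟩ := hW'
  have ML := hgt_mkM_left m n (by omega) V W w
  have MM := hgt_mkM_mid m n e hn V W w v1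
  have MR := hgt_mkM_right m n e hn V W w v1
  have PL := hgt_mkP_left m n (by omega) V' W' w
  have PM := hgt_mkP_mid m n e hn V' W' w v1'
  have PR := hgt_mkP_right m n e hn V' W' w v1'
  have cases3 : ∀ i ≤ n, i ≤ m ∨ (∃ k, 0 < k ∧ k ≤ e ∧ i = m + k) ∨
      (∃ k, 0 < k ∧ k ≤ m ∧ i = m + e + k) := by
    intro i hi
    by_cases h : i ≤ m
    · exact Or.inl h
    by_cases h' : i ≤ m + e
    · exact Or.inr (Or.inl ⟨i - m, by omega, by omega, by omega⟩)
    · exact Or.inr (Or.inr ⟨i - m - e, by omega, by omega, by omega⟩)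
  have hwpos : (0 : ℤ) < w := by rw [← v1]; exact v2 m hm le_rfl
  have hM0 : hgt (w : ℤ) (mkM m n V W) m = 0 := by rw [ML m le_rfl, v1]; ring
  have hMpos : ∀ i ≤ n, i ≠ m → 0 < hgt (w : ℤ) (mkM m n V W) i := by
    intro i hi him
    rcases cases3 i hi with h | ⟨k, hk0, hk, rfl⟩ | ⟨k, hk0, hk, rfl⟩
    · rw [ML i h]; have := v3 i (by omega); omega
    · rw [MM k hk]; omega
    · rw [MR k hk]; have := w2 k hk0 hk; omega
  have hlt : ∀ i, 0 < i → i < n → hgt (w : ℤ) (mkM m n V W) i < hgt (w : ℤ) (mkP m n V' W') i := by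
    intro i h0 hi
    rcases cases3 i hi.le with h | ⟨k, hk0, hk, rfl⟩ | ⟨k, hk0, hk, rfl⟩
    · rw [ML i h, PL i h]; have := v2 i h0 h; have := v2' i h0 h; omega
    · rw [MM k hk, PM k hk]; omega
    · rw [MR k hk, PR k hk]; have := w3 k (by omega); have := w3' k (by omega); omega
  have hend : hgt (w : ℤ) (mkP m n V' W') n = hgt (w : ℤ) (mkM m n V W) n := by
    have h := PR m le_rfl
    have h' := MR m le_rfl
    rw [show m + e + m = n by omega] at h h'
    rw [h, h', w1, w1']; ring
  have hUM : InUHP (w : ℤ) (mkM m n V W) := by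
    intro i hi
    by_cases h : i = m
    · rw [h, hM0]
    · exact (hMpos i hi h).le
  refine ⟨⟨hend, hlt, ?_, hUM, m, by omega, Or.inr hM0⟩, hM0, ?_, ?_⟩
  · intro i hi
    rcases Nat.eq_zero_or_pos i with rfl | h0
    · rw [hgt_zero]; omega
    rcases hi.eq_or_lt with rfl | h1
    · rw [hend]; exact hUM _ le_rfl
    · exact (hUM i hi).trans (hlt i h0 h1).le
  · rw [PL m le_rfl, v1']; ring
  · unfold visits
    rw [Finset.card_eq_one]
    refine ⟨m, ?_⟩
    ext i
    simp only [mem_filter, mem_range, mem_singleton]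
    constructor
    · rintro ⟨h1, h2⟩
      by_contra h
      have := hMpos i (by omega) h
      omega
    · rintro rfl
      exact ⟨by omega, hM0⟩

theorem PC_lb (n m : ℕ) (hm : m = n / 2) (hm0 : 0 < m) (w : ℕ) (hw : w ≤ n) (a y : ℝ)
    (ha : 0 < a) (hy : 1 < y) :
    ((good m w).card : ℝ) ^ 4 * (a * y ^ (2 * w)) ≤ PC n a y := by
  have hn : n = 2 * m + n % 2 := by omega
  let F : ((Fin m → Bool) × (Fin m → Bool)) × ((Fin m → Bool) × (Fin m → Bool)) →
      Fin (n + 1) × (Fin n → Bool) × (Fin n → Bool) :=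
    fun q => (⟨w, by omega⟩, mkP m n q.1.1 q.1.2, mkM m n q.2.1 q.2.2)
  let D := ((good m w) ×ˢ (good m w)) ×ˢ ((good m w) ×ˢ (good m w))
  have hF : Function.Injective F := by
    rintro ⟨⟨x1, x2⟩, x3, x4⟩ ⟨⟨y1, y2⟩, y3, y4⟩ h
    simp only [F, Prod.mk.injEq, true_and] at h
    obtain ⟨r1, r2⟩ := mkP_inj m n (by omega) _ _ _ _ h.1
    obtain ⟨r3, r4⟩ := mkM_inj m n (by omega) _ _ _ _ h.2
    simp [r1, r2, r3, r4]
  have hspec : ∀ q ∈ D, IsStaircase (w : ℤ) (F q).2.1 (F q).2.2 ∧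
      hgt (w : ℤ) (F q).2.2 m = 0 ∧ hgt (w : ℤ) (F q).2.1 m = 2 * w ∧
      visits (w : ℤ) (F q).2.2 = 1 := by
    rintro ⟨⟨x1, x2⟩, x3, x4⟩ hq
    simp only [D, mem_product] at hq
    exact good_spec m n (n % 2) hn w hm0 _ _ _ _ hq.2.1 hq.2.2 hq.1.1 hq.1.2
  have hcard : ((good m w).card : ℝ) ^ 4 * (a * y ^ (2 * w)) = ∑ q ∈ D, a * y ^ (2 * w) := by
    simp only [sum_const, nsmul_eq_mul, D, card_product]
    push_cast; ring
  rw [hcard]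
  unfold PC
  rw [← hm]
  calc ∑ q ∈ D, a * y ^ (2 * w)
      = ∑ q ∈ D, a ^ visits (((F q).1 : ℕ) : ℤ) (F q).2.2 *
          y ^ hgt (((F q).1 : ℕ) : ℤ) (F q).2.1 m := by
        refine Finset.sum_congr rfl fun q hq => ?_
        obtain ⟨_, _, h3, h4⟩ := hspec q hq
        have : (((F q).1 : ℕ) : ℤ) = w := rfl
        rw [this, h3, h4, pow_one]
        norm_cast
    _ = ∑ p ∈ D.image F, a ^ visits ((p.1 : ℕ) : ℤ) p.2.2 * y ^ hgt ((p.1 : ℕ) : ℤ) p.2.1 m := by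
        rw [Finset.sum_image hF.injOn]
    _ ≤ _ := by
        refine Finset.sum_le_sum_of_subset_of_nonneg ?_ ?_
        · intro p hp
          obtain ⟨q, hq, rfl⟩ := Finset.mem_image.1 hp
          obtain ⟨h1, h2, _, _⟩ := hspec q hq
          simp only [mem_filter, mem_univ, true_and]
          exact ⟨h1, h2⟩
        · intro p _ _
          positivity

theorem PC_ub (n : ℕ) (a y : ℝ) (ha : 0 < a) (hy : 1 < y) (hn : 1 ≤ n) :
    PC n a y ≤ (8 * (max 1 a) ^ 2 * y ^ 2) ^ n := by
  have hM : (1 : ℝ) ≤ max 1 a := le_max_left _ _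
  have hterm : ∀ p : Fin (n + 1) × (Fin n → Bool) × (Fin n → Bool),
      a ^ visits ((p.1 : ℕ) : ℤ) p.2.2 * y ^ hgt ((p.1 : ℕ) : ℤ) p.2.1 (n / 2) ≤
      (max 1 a) ^ (2 * n) * y ^ (2 * n) := by
    intro p
    have hv : visits ((p.1 : ℕ) : ℤ) p.2.2 ≤ 2 * n := by
      unfold visits
      refine (Finset.card_filter_le _ _).trans ?_
      simp; omega
    have hh := (hgt_abs ((p.1 : ℕ) : ℤ) p.2.1 (n / 2) (by omega)).1
    have hp := p.1.2
    refine mul_le_mul ?_ ?_ (by positivity) (by positivity)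
    · exact (pow_le_pow_left₀ ha.le (le_max_right _ _) _).trans (pow_le_pow_right₀ hM hv)
    · rw [← zpow_natCast]
      exact zpow_le_zpow_right₀ hy.le (by push_cast; omega)
  unfold PC
  calc _ ≤ ∑ p : Fin (n + 1) × (Fin n → Bool) × (Fin n → Bool),
        a ^ visits ((p.1 : ℕ) : ℤ) p.2.2 * y ^ hgt ((p.1 : ℕ) : ℤ) p.2.1 (n / 2) := by
        refine Finset.sum_le_sum_of_subset_of_nonneg (Finset.filter_subset _ _) ?_
        intro p _ _
        positivity
    _ ≤ ∑ p : Fin (n + 1) × (Fin n → Bool) × (Fin n → Bool),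
          (max 1 a) ^ (2 * n) * y ^ (2 * n) := Finset.sum_le_sum fun p _ => hterm p
    _ = ((n + 1) * (2 ^ n * 2 ^ n)) * ((max 1 a) ^ (2 * n) * y ^ (2 * n)) := by
        simp
    _ ≤ (2 ^ n * (2 ^ n * 2 ^ n)) * ((max 1 a) ^ (2 * n) * y ^ (2 * n)) := by
        gcongr
        exact_mod_cast Nat.lt_two_pow_self
    _ = _ := by
        rw [pow_mul, pow_mul, ← mul_pow, ← mul_pow, ← mul_pow, ← mul_pow]
        norm_num [mul_assoc]


/-- The word made of `A` up steps, then blocks `f k`, then up steps. -/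
noncomputable def word (m A q L : ℕ) (f : Fin q → Finset (Fin L)) : Fin m → Bool := fun j =>
  if (j : ℕ) < A then true else
    if h : ((j : ℕ) - A) / L < q ∧ ((j : ℕ) - A) % L < L then
      decide (⟨((j : ℕ) - A) % L, h.2⟩ ∈ f ⟨((j : ℕ) - A) / L, h.1⟩) else true

theorem word_block (m A q L : ℕ) (f : Fin q → Finset (Fin L)) (k r : ℕ) (hk : k < q) (hr : r < L)
    (h : A + k * L + r < m) :
    word m A q L f ⟨A + k * L + r, h⟩ = decide ((⟨r, hr⟩ : Fin L) ∈ f ⟨k, hk⟩) := by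
  have h1 : A + k * L + r - A = r + L * k := by rw [mul_comm L k]; omega
  have h2 : (A + k * L + r - A) / L = k := by
    rw [h1, Nat.add_mul_div_left _ _ (by omega), Nat.div_eq_of_lt hr]; omega
  have h3 : (A + k * L + r - A) % L = r := by
    rw [h1, Nat.add_mul_mod_self_left, Nat.mod_eq_of_lt hr]
  have h4 : ¬ (A + k * L + r < A) := by omega
  simp [word, h2, h3, h4, hk, hr]

theorem word_end (m A q L : ℕ) (hL : 0 < L) (f : Fin q → Finset (Fin L)) (j : ℕ)
    (hj : A + q * L ≤ j) (h : j < m) : word m A q L f ⟨j, h⟩ = true := by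
  have : ¬ ((j - A) / L < q) := by
    rw [Nat.div_lt_iff_lt_mul hL]; omega
  simp [word, this]

theorem word_start (m A q L : ℕ) (f : Fin q → Finset (Fin L)) (j : ℕ)
    (hj : j < A) (h : j < m) : word m A q L f ⟨j, h⟩ = true := by
  simp [word, hj]

/-- indicator word of a set -/
noncomputable def indw {L : ℕ} (t : Finset (Fin L)) : Fin L → Bool := fun j => decide (j ∈ t)

theorem hgt_indw {L : ℕ} (t : Finset (Fin L)) : hgt 0 (indw t) L = 2 * (t.card : ℤ) - L := by
  have : hgt 0 (indw t) L = ∑ j : Fin L, (if j ∈ t then (1 : ℤ) else -1) := by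
    rw [hgt, zero_add, Finset.sum_range]
    refine Finset.sum_congr rfl fun j _ => ?_
    simp [indw]
  rw [this]
  have h2 : ∀ j : Fin L, (if j ∈ t then (1 : ℤ) else -1) = 2 * (if j ∈ t then 1 else 0) - 1 := by
    intro j; split_ifs <;> norm_num
  simp only [h2, Finset.sum_sub_distrib, ← Finset.mul_sum]
  simp

theorem hgt_lip {n : ℕ} (c : ℤ) (s : Fin n → Bool) (i k : ℕ) (h : i + k ≤ n) :
    hgt c s (i + k) ≤ hgt c s i + k ∧ hgt c s i - k ≤ hgt c s (i + k) := by
  induction k with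
  | zero => simp
  | succ k ih =>
    have := ih (by omega)
    rw [← add_assoc, hgt_succ c s (i + k) (by omega)]
    push_cast
    split_ifs <;> omega

theorem hgt_word_start (m A q L : ℕ) (f : Fin q → Finset (Fin L)) (hA : A ≤ m) (i : ℕ) (hi : i ≤ A) :
    hgt 0 (word m A q L f) i = i := by
  induction i with
  | zero => simp [hgt_zero]
  | succ i ih =>
    rw [hgt_succ _ _ _ (by omega), ih (by omega), word_start m A q L f i (by omega)]
    simp

theorem hgt_word_in (m A q L : ℕ) (f : Fin q → Finset (Fin L)) (k : ℕ) (hk : k < q)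
    (hm : A + q * L ≤ m) (r : ℕ) (hr : r ≤ L) :
    hgt 0 (word m A q L f) (A + k * L + r) =
      hgt 0 (word m A q L f) (A + k * L) + hgt 0 (indw (f ⟨k, hk⟩)) r := by
  have hkq : (k + 1) * L ≤ q * L := Nat.mul_le_mul_right _ hk
  rw [add_mul, one_mul] at hkq
  induction r with
  | zero => simp [hgt_zero]
  | succ r ih =>
    rw [← add_assoc, hgt_succ _ _ _ (by omega), hgt_succ _ _ _ (by omega), ih (by omega),
      word_block m A q L f k r hk (by omega)]
    simp [indw, add_assoc]

theorem hgt_word_block (m A q L u : ℕ) (f : Fin q → Finset (Fin L)) (hf : ∀ k, (f k).card = u)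
    (hm : A + q * L ≤ m) (k : ℕ) (hk : k ≤ q) :
    hgt 0 (word m A q L f) (A + k * L) = A + k * (2 * (u : ℤ) - L) := by
  induction k with
  | zero => simp; exact hgt_word_start m A q L f (by omega) A le_rfl
  | succ k ih =>
    have := hgt_word_in m A q L f k (by omega) hm L le_rfl
    rw [add_mul, one_mul, ← add_assoc, this, ih (by omega), hgt_indw, hf]
    push_cast; ring

theorem hgt_word_end (m A q L u : ℕ) (hL : 0 < L) (f : Fin q → Finset (Fin L))
    (hf : ∀ k, (f k).card = u) (i : ℕ)
    (hm : A + q * L + i ≤ m) :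
    hgt 0 (word m A q L f) (A + q * L + i) = A + q * (2 * (u : ℤ) - L) + i := by
  induction i with
  | zero => simp; exact hgt_word_block m A q L u f hf (by omega) q le_rfl
  | succ i ih =>
    rw [← add_assoc, hgt_succ _ _ _ (by omega), ih (by omega),
      word_end m A q L hL f _ (by omega)]
    simp [add_assoc]

theorem word_good (A B q L u d : ℕ) (hL : 0 < L) (hd : 2 * u = L + d) (hA : L < A) (hB : L < B)
    (f : Fin q → Finset (Fin L)) (hf : ∀ k, (f k).card = u) :
    word (A + q * L + B) A q L f ∈ good (A + q * L + B) ((A + q * d + B : ℕ) : ℤ) := by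
  have hd' : 2 * (u : ℤ) - L = d := by omega
  have S := hgt_word_start (A + q * L + B) A q L f (by omega)
  have K := hgt_word_block (A + q * L + B) A q L u f hf (by omega)
  have E := hgt_word_end (A + q * L + B) A q L u hL f hf
  rw [hd'] at K E
  have cases3 : ∀ i ≤ A + q * L + B, i ≤ A ∨ (∃ k r, k < q ∧ r < L ∧ i = A + k * L + r) ∨
      (∃ k, k ≤ B ∧ i = A + q * L + k) := by
    intro i hi
    by_cases h : i ≤ A
    · exact Or.inl h
    by_cases h' : i < A + q * L
    · refine Or.inr (Or.inl ⟨(i - A) / L, (i - A) % L, ?_, Nat.mod_lt _ hL, ?_⟩)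
      · rw [Nat.div_lt_iff_lt_mul hL]; omega
      · have := Nat.div_add_mod' (i - A) L
        omega
    · exact Or.inr (Or.inr ⟨i - (A + q * L), by omega, by omega⟩)
  simp only [good, mem_filter, mem_univ, true_and]
  have hblk : ∀ k r, k < q → r < L →
      0 < hgt 0 (word (A + q * L + B) A q L f) (A + k * L + r) ∧
      hgt 0 (word (A + q * L + B) A q L f) (A + k * L + r) < (A + q * d + B : ℕ) := by
    intro k r hk hr
    have hkq : (k + 1) * L ≤ q * L := Nat.mul_le_mul_right _ hk
    rw [add_mul, one_mul] at hkq
    have hkd : k * d ≤ q * d := Nat.mul_le_mul_right _ hk.le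
    have := hgt_lip 0 (word (A + q * L + B) A q L f) (A + k * L) r (by omega)
    rw [K k hk.le] at this
    zify at hkd
    have h0 : (0 : ℤ) ≤ k * d := by positivity
    push_cast
    constructor <;> omega
  have hq0 : (0 : ℤ) ≤ q * d := by positivity
  refine ⟨?_, ?_, ?_⟩
  · rw [E B le_rfl]; push_cast; ring
  · intro i h0 hi
    rcases cases3 i hi with h | ⟨k, r, hk, hr, rfl⟩ | ⟨k, hk, rfl⟩
    · rw [S i h]; omega
    · exact (hblk k r hk hr).1
    · rw [E k (by omega)]; omega
  · intro i hi
    rcases cases3 i hi.le with h | ⟨k, r, hk, hr, rfl⟩ | ⟨k, hk, rfl⟩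
    · rw [S i h]; push_cast; omega
    · exact (hblk k r hk hr).2
    · rw [E k (by omega)]; push_cast; omega

theorem word_inj (A B q L : ℕ) : Function.Injective (word (A + q * L + B) A q L) := by
  intro f g h
  funext ⟨k, hk⟩
  ext ⟨r, hr⟩
  have hkq : (k + 1) * L ≤ q * L := Nat.mul_le_mul_right _ hk
  rw [add_mul, one_mul] at hkq
  have := congrFun h ⟨A + k * L + r, by omega⟩
  rw [word_block _ _ _ _ _ k r hk hr, word_block _ _ _ _ _ k r hk hr] at this
  simpa using this

theorem good_card (A B q L u d : ℕ) (hL : 0 < L) (hd : 2 * u = L + d) (hA : L < A) (hB : L < B) :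
    (L.choose u) ^ q ≤ (good (A + q * L + B) ((A + q * d + B : ℕ) : ℤ)).card := by
  have h1 : (L.choose u) ^ q =
      (Fintype.piFinset (fun _ : Fin q => (Finset.univ : Finset (Fin L)).powersetCard u)).card := by
    simp [Fintype.card_piFinset]
  rw [h1]
  refine Finset.card_le_card_of_injOn (word (A + q * L + B) A q L) ?_ (word_inj A B q L).injOn
  intro f hf
  have hf' : ∀ k, (f k).card = u := by
    intro k
    have := Fintype.mem_piFinset.1 (Finset.mem_coe.1 hf) k
    exact (Finset.mem_powersetCard.1 this).2
  exact word_good A B q L u d hL hd hA hB f hf'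

theorem exists_u (L : ℕ) (y : ℝ) (hy : 1 < y) :
    ∃ u, L ≤ 2 * u ∧ u ≤ L ∧ (1 + y) ^ L ≤ (L + 1) * ((L.choose u : ℝ) * y ^ u) := by
  obtain ⟨u, hu, hmax⟩ := Finset.exists_max_image (Finset.range (L + 1))
    (fun u => (L.choose u : ℝ) * y ^ u) ⟨0, by simp⟩
  have huL : u ≤ L := by simpa [Nat.lt_succ_iff] using hu
  have hs : (1 + y) ^ L ≤ (L + 1) * ((L.choose u : ℝ) * y ^ u) := by
    rw [add_comm 1 y, add_pow]
    calc _ ≤ ∑ k ∈ Finset.range (L + 1), (L.choose u : ℝ) * y ^ u := by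
          refine Finset.sum_le_sum fun k hk => ?_
          have := hmax k hk
          simpa [mul_comm] using this
      _ = _ := by simp
  by_cases h : L ≤ 2 * u
  · exact ⟨u, h, huL, hs⟩
  · refine ⟨L - u, by omega, by omega, hs.trans ?_⟩
    rw [Nat.choose_symm huL]
    have : y ^ u ≤ y ^ (L - u) := pow_le_pow_right₀ hy.le (by omega)
    gcongr

theorem log_PC_lb (a y : ℝ) (ha : 0 < a) (hy : 1 < y) (L : ℕ) (hL : 0 < L) (n : ℕ)
    (hn : 8 * L + 8 ≤ n) :
    ∃ Q : ℕ, 4 * Q ≤ 2 * n ∧ 2 * n ≤ 4 * Q + (12 * L + 12) ∧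
      Real.log a + 4 * Q * (Real.log (1 + y) - Real.log (L + 1) / L - Real.log y / 2) ≤
        Real.log (PC n a y) ∧ 0 < PC n a y := by
  obtain ⟨u, hu1, hu2, hu⟩ := exists_u L y hy
  obtain ⟨d, hd⟩ : ∃ d, 2 * u = L + d := ⟨2 * u - L, by omega⟩
  set q := (n / 2 - (2 * L + 2)) / L with hq
  set r := (n / 2 - (2 * L + 2)) % L with hr
  have hqr : q * L + r = n / 2 - (2 * L + 2) := Nat.div_add_mod' _ _
  have hrL : r < L := Nat.mod_lt _ hL
  have hm : (L + 1 + r) + q * L + (L + 1) = n / 2 := by omega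
  have hdL : q * d ≤ q * L := Nat.mul_le_mul_left _ (by omega)
  have hc := good_card (L + 1 + r) (L + 1) q L u d hL hd (by omega) (by omega)
  set w := (L + 1 + r) + q * d + (L + 1) with hw
  rw [hm] at hc
  have hp := PC_lb n (n / 2) rfl (by omega) w (by omega) a y ha hy
  have hCpos : 0 < L.choose u := Nat.choose_pos hu2
  have hC : (0 : ℝ) < L.choose u := by exact_mod_cast hCpos
  have hy0 : 0 < y := by linarith
  have hly : 0 < Real.log y := Real.log_pos hy
  have hLR : (0 : ℝ) < L := by exact_mod_cast hL
  have h1 : (((L.choose u : ℝ)) ^ q) ^ 4 * (a * y ^ (2 * (q * d))) ≤ PC n a y := by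
    refine le_trans ?_ hp
    have hc' : ((L.choose u : ℝ)) ^ q ≤ ((good (n / 2) (w : ℤ)).card : ℝ) := by exact_mod_cast hc
    have : y ^ (2 * (q * d)) ≤ y ^ (2 * w) := pow_le_pow_right₀ hy.le (by omega)
    gcongr
  have hpos : 0 < (((L.choose u : ℝ)) ^ q) ^ 4 * (a * y ^ (2 * (q * d))) := by positivity
  refine ⟨q * L, by omega, by omega, ?_, hpos.trans_le h1⟩
  refine le_trans ?_ (Real.log_le_log hpos h1)
  rw [Real.log_mul (by positivity) (by positivity), Real.log_mul (by positivity) (by positivity),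
    Real.log_pow, Real.log_pow, Real.log_pow]
  have hu' := Real.log_le_log (by positivity) hu
  rw [Real.log_pow, Real.log_mul (by positivity) (by positivity),
    Real.log_mul (by positivity) (by positivity), Real.log_pow] at hu'
  have hdR : (d : ℝ) = 2 * u - L := by
    have : (2 * u : ℝ) = L + d := by exact_mod_cast hd
    linarith
  push_cast
  rw [hdR]
  have hq0 : (0 : ℝ) ≤ 4 * q := by positivity
  have := mul_le_mul_of_nonneg_left hu' hq0
  have e1 : 4 * ((q : ℝ) * L) * (Real.log (1 + y) - Real.log (L + 1) / L - Real.log y / 2) =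
    4 * q * (L * Real.log (1 + y)) - 4 * q * Real.log (L + 1) - 2 * q * L * Real.log y := by
    field_simp
    ring
  rw [e1]
  linarith

theorem step (a y : ℝ) (ha : 0 < a) (hy : 1 < y) (L : ℕ) (hL : 0 < L) (δ : ℝ) (hδ : 0 < δ) :
    ∀ᶠ n : ℕ in atTop, (Real.log (1 + y) - Real.log (L + 1) / L - Real.log y / 2) - δ ≤
      Real.log (PC n a y) / (2 * n) := by
  set T := Real.log (1 + y) - Real.log (L + 1) / L - Real.log y / 2 with hT
  obtain ⟨N, hN⟩ := exists_nat_gt ((|Real.log a| + (12 * L + 12) * |T|) / δ)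
  filter_upwards [eventually_ge_atTop (max N (8 * L + 8))] with n hn
  have hn1 : N ≤ n := (le_max_left _ _).trans hn
  have hn2 : 8 * L + 8 ≤ n := (le_max_right _ _).trans hn
  obtain ⟨Q, q1, q2, q3, -⟩ := log_PC_lb a y ha hy L hL n hn2
  rw [← hT] at q3
  have hn0 : (0 : ℝ) < n := by
    have : 0 < n := by omega
    exact_mod_cast this
  rw [le_div_iff₀ (by positivity)]
  rw [div_lt_iff₀ hδ] at hN
  have hn1' : (N : ℝ) ≤ n := by exact_mod_cast hn1
  have q1' : (4 * Q : ℝ) ≤ 2 * n := by exact_mod_cast q1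
  have q2' : (2 * n : ℝ) ≤ 4 * Q + (12 * L + 12) := by exact_mod_cast q2
  have a1 := neg_abs_le (Real.log a)
  have a2 : (2 * n - 4 * Q : ℝ) * T ≤ (12 * L + 12) * |T| := by
    calc (2 * n - 4 * Q : ℝ) * T ≤ (2 * n - 4 * Q : ℝ) * |T| := 
          mul_le_mul_of_nonneg_left (le_abs_self T) (by linarith)
      _ ≤ _ := by gcongr; linarith
  have a3 : (N : ℝ) * δ ≤ n * δ := by gcongr
  have a4 : 0 < (n : ℝ) * δ := by positivity
  nlinarith

theorem log_div_tendsto : Tendsto (fun L : ℕ => Real.log ((L : ℝ) + 1) / L) atTop (nhds 0) := by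
  have h := Real.isLittleO_log_id_atTop.tendsto_div_nhds_zero
  have h1 : Tendsto (fun L : ℕ => ((L + 1 : ℕ) : ℝ)) atTop atTop :=
    tendsto_natCast_atTop_atTop.comp (tendsto_add_atTop_nat 1)
  have h2 := h.comp h1
  have h3 : Tendsto (fun L : ℕ => 1 + 1 / (L : ℝ)) atTop (nhds (1 + 0)) :=
    tendsto_const_nhds.add tendsto_one_div_atTop_nhds_zero_nat
  have h4 := h2.mul h3
  rw [zero_mul] at h4
  refine h4.congr' ?_
  filter_upwards [eventually_gt_atTop 0] with L hL
  have : (0 : ℝ) < L := by exact_mod_cast hL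
  simp only [Function.comp, id]
  push_cast
  field_simp

end PCaux

/-- Lower bound for the `liminf` of centred polygons when `y > 1`. -/
theorem PC_liminf_lb (a y : ℝ) (ha : 0 < a) (hy : 1 < y) :
    Real.log (y + 1) - (1/2) * Real.log y ≤
      Filter.liminf (fun n : ℕ => Real.log (PC n a y) / (2 * n)) atTop := by
  have hbdd : IsBoundedUnder (· ≤ ·) atTop (fun n : ℕ => Real.log (PC n a y) / (2 * n)) := by
    refine isBoundedUnder_of_eventually_le
      (a := Real.log (8 * (max 1 a) ^ 2 * y ^ 2) / 2) ?_
    filter_upwards [eventually_ge_atTop 16] with n hn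
    obtain ⟨_, -, -, -, hpos⟩ := PCaux.log_PC_lb a y ha hy 1 one_pos n (by omega)
    have h := Real.log_le_log hpos (PCaux.PC_ub n a y ha hy (by omega))
    rw [Real.log_pow] at h
    have hn0 : (0 : ℝ) < n := by
      have : 0 < n := by omega
      exact_mod_cast this
    rw [div_le_div_iff₀ (by positivity) (by positivity)]
    nlinarith
  refine le_of_forall_pos_sub_le fun ε hε => ?_
  refine le_liminf_of_le hbdd.isCoboundedUnder_ge ?_
  have hev := PCaux.log_div_tendsto.eventually (gt_mem_nhds (half_pos hε))
  obtain ⟨L, hL1, hL2⟩ := (hev.and (eventually_gt_atTop 0)).exists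
  filter_upwards [PCaux.step a y ha hy L hL2 (ε / 2) (half_pos hε)] with n hn
  rw [add_comm y 1]
  linarith
end
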